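/- arXiv:2210.03528 — 9 statements merged into one kernel-verified Lean document; each statement's English description precedes it below -/
import Mathlib

section
/- Let d ≥ k ≥ 3 and let Φ ∈ ℝ^{d×k} be a matrix whose rows Φ_1,…,Φ_d span ℝ^k. Then there exists a probability distribution ρ on {1,…,d} such that G(ρ) = Σ_{i=1}^d ρ(i)·Φ_i Φ_iᵀ is invertible, g(ρ) = max_{i∈[d]} Φ_iᵀ G(ρ)^{-1} Φ_i ≤ 2k, and the support of ρ has cardinality at most 4k·log(log k) + 16 (natural logarithms). -/
open scoped BigOperators Matrix

/-- The design matrix `G(ρ) = ∑ i, ρ(i) • Φ_i Φ_iᵀ`. -/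
noncomputable def designMatrix {d k : ℕ} (Φ : Matrix (Fin d) (Fin k) ℝ)
    (ρ : Fin d → ℝ) : Matrix (Fin k) (Fin k) ℝ :=
  ∑ i : Fin d, ρ i • Matrix.vecMulVec (Φ i) (Φ i)

section Exchange

variable {ι κ : Type*} [Fintype ι]

lemma transpose_mul_self_eq_sum_vecMulVec (B : Matrix ι κ ℝ) :
    Bᵀ * B = ∑ a, Matrix.vecMulVec (B a) (B a) := by
  ext i j
  simp [Matrix.mul_apply, Matrix.sum_apply, Matrix.vecMulVec_apply]

lemma transpose_mul_self_updateRow [DecidableEq ι] (B : Matrix ι κ ℝ) (a : ι) (u : κ → ℝ) :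
    (B.updateRow a u)ᵀ * B.updateRow a u =
      Bᵀ * B + Matrix.vecMulVec u u - Matrix.vecMulVec (B a) (B a) := by
  simp only [transpose_mul_self_eq_sum_vecMulVec]
  rw [← Finset.add_sum_erase _ _ (Finset.mem_univ a),
    ← Finset.add_sum_erase _ (fun b => Matrix.vecMulVec (B b) (B b)) (Finset.mem_univ a)]
  have hrest : ∀ b ∈ Finset.univ.erase a,
      Matrix.vecMulVec (B.updateRow a u b) (B.updateRow a u b) =
        Matrix.vecMulVec (B b) (B b) := by
    intro b hb
    rw [Matrix.updateRow_ne (Finset.ne_of_mem_erase hb)]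
  rw [Finset.sum_congr rfl hrest, Matrix.updateRow_self]
  abel

variable [Fintype κ] [DecidableEq κ]

/-- The effect on the determinant of adding one rank-one term and removing another. -/
lemma det_add_vecMulVec_sub_vecMulVec (A : Matrix κ κ ℝ) (hA : IsUnit A.det) (hs : A.IsSymm)
    (u v : κ → ℝ) :
    (A + Matrix.vecMulVec u u - Matrix.vecMulVec v v).det =
      A.det * ((1 + u ⬝ᵥ (A⁻¹ *ᵥ u)) * (1 - v ⬝ᵥ (A⁻¹ *ᵥ v)) + (v ⬝ᵥ (A⁻¹ *ᵥ u)) ^ 2) := by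
  have hfactor : A + Matrix.vecMulVec u u - Matrix.vecMulVec v v =
      A + (Matrix.of ![u, v])ᵀ * Matrix.of ![u, -v] := by
    ext i j
    simp [Matrix.mul_apply, Matrix.vecMulVec_apply, Fin.sum_univ_two]
    ring
  have hentry : ∀ (x y : Fin 2 → κ → ℝ) (i j : Fin 2),
      (Matrix.of x * A⁻¹ * (Matrix.of y)ᵀ) i j = x i ⬝ᵥ (A⁻¹ *ᵥ y j) := by
    intro x y i j
    rw [Matrix.mul_assoc]
    rfl
  have hsymm : u ⬝ᵥ (A⁻¹ *ᵥ v) = v ⬝ᵥ (A⁻¹ *ᵥ u) := by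
    have hs' : (A⁻¹)ᵀ = A⁻¹ := by rw [Matrix.transpose_nonsing_inv, hs.eq]
    rw [Matrix.dotProduct_mulVec, ← Matrix.mulVec_transpose, hs', dotProduct_comm]
  rw [hfactor, Matrix.det_add_mul _ _ hA, Matrix.det_fin_two]
  simp only [Matrix.add_apply, hentry]
  simp only [Fin.isValue, Matrix.cons_val_zero, Matrix.cons_val_one, Matrix.one_apply_eq, ne_eq,
    zero_ne_one, one_ne_zero, not_false_eq_true, Matrix.one_apply_ne, neg_dotProduct, hsymm]
  ring

/-- The leverage scores of the rows of a matrix of full column rank sum to the rank. -/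
lemma sum_leverage (B : Matrix ι κ ℝ) (hB : IsUnit (Bᵀ * B).det) :
    ∑ a, B a ⬝ᵥ ((Bᵀ * B)⁻¹ *ᵥ B a) = Fintype.card κ := by
  have htrace : ∑ a, B a ⬝ᵥ ((Bᵀ * B)⁻¹ *ᵥ B a) = (B * ((Bᵀ * B)⁻¹ * Bᵀ)).trace := rfl
  rw [htrace, Matrix.trace_mul_comm, Matrix.mul_assoc, Matrix.nonsing_inv_mul _ hB,
    Matrix.trace_one]

lemma sum_sq_cross_leverage (B : Matrix ι κ ℝ) (hB : IsUnit (Bᵀ * B).det) (u : κ → ℝ) :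
    ∑ a, (B a ⬝ᵥ ((Bᵀ * B)⁻¹ *ᵥ u)) ^ 2 = u ⬝ᵥ ((Bᵀ * B)⁻¹ *ᵥ u) := by
  set w := (Bᵀ * B)⁻¹ *ᵥ u with hw
  have hu : u = (Bᵀ * B) *ᵥ w := by
    rw [hw, Matrix.mulVec_mulVec, Matrix.mul_nonsing_inv _ hB, Matrix.one_mulVec]
  have hsum : ∑ a, (B a ⬝ᵥ w) ^ 2 = (B *ᵥ w) ⬝ᵥ (B *ᵥ w) := by
    simp only [dotProduct, Matrix.mulVec, pow_two]
  conv_rhs => rw [hu]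
  rw [hsum, ← Matrix.mulVec_mulVec, Matrix.mulVec_transpose, ← Matrix.dotProduct_mulVec]

/-- If no single exchange of a row of `B` for `u` increases the Gram determinant, then the
leverage of `u` is at most `k / (m - k + 1)`. -/
lemma leverage_le_of_forall_exchange [DecidableEq ι] (B : Matrix ι κ ℝ) (hB : 0 < (Bᵀ * B).det) (u : κ → ℝ)
    (hmax : ∀ a, ((B.updateRow a u)ᵀ * B.updateRow a u).det ≤ (Bᵀ * B).det) :
    ((Fintype.card ι : ℝ) - Fintype.card κ + 1) * (u ⬝ᵥ ((Bᵀ * B)⁻¹ *ᵥ u)) ≤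
      Fintype.card κ := by
  have hunit : IsUnit (Bᵀ * B).det := hB.ne'.isUnit
  have hsymm : (Bᵀ * B).IsSymm := by
    rw [Matrix.IsSymm, Matrix.transpose_mul, Matrix.transpose_transpose]
  have hlocal : ∀ a, (1 + u ⬝ᵥ ((Bᵀ * B)⁻¹ *ᵥ u)) * (1 - B a ⬝ᵥ ((Bᵀ * B)⁻¹ *ᵥ B a)) +
      (B a ⬝ᵥ ((Bᵀ * B)⁻¹ *ᵥ u)) ^ 2 ≤ 1 := by
    intro a
    have h := hmax a
    rw [transpose_mul_self_updateRow, det_add_vecMulVec_sub_vecMulVec _ hunit hsymm] at h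
    exact le_of_mul_le_mul_left (h.trans_eq (mul_one _).symm) hB
  have hsum := Finset.sum_le_sum fun a (_ : a ∈ Finset.univ) => hlocal a
  rw [Finset.sum_add_distrib, ← Finset.mul_sum, Finset.sum_sub_distrib, sum_leverage B hunit,
    sum_sq_cross_leverage B hunit] at hsum
  simp only [Finset.sum_const, Finset.card_univ, nsmul_eq_mul, mul_one] at hsum
  linarith

lemma det_transpose_mul_self_nonneg (B : Matrix ι κ ℝ) : 0 ≤ (Bᵀ * B).det := by
  simpa using (Matrix.posSemidef_conjTranspose_mul_self B).det_nonneg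

lemma det_transpose_mul_self_pos (B : Matrix ι κ ℝ)
    (hspan : Submodule.span ℝ (Set.range fun a => B a) = ⊤) : 0 < (Bᵀ * B).det := by
  refine (det_transpose_mul_self_nonneg B).lt_of_ne' fun hdet => ?_
  obtain ⟨x, hx, hBx⟩ := Matrix.exists_mulVec_eq_zero_iff.2 hdet
  rw [← Matrix.conjTranspose_eq_transpose_of_trivial,
    Matrix.conjTranspose_mul_self_mulVec_eq_zero] at hBx
  have hmem : x ∈ Submodule.span ℝ (Set.range fun a => B a) := hspan ▸ Submodule.mem_top
  have horth : ∀ y ∈ Submodule.span ℝ (Set.range fun a => B a), y ⬝ᵥ x = 0 := by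
    intro y hy
    induction hy using Submodule.span_induction with
    | mem y hy =>
      obtain ⟨a, rfl⟩ := hy
      exact congrFun hBx a
    | zero => simp
    | add y z _ _ hy hz => rw [add_dotProduct, hy, hz, add_zero]
    | smul c y _ hy => rw [smul_dotProduct, hy, smul_zero]
  exact hx (dotProduct_self_eq_zero.1 (horth x hmem))

end Exchange

/-- A spanning family of rows contains a spanning subfamily of any prescribed length `m ≥ k`. -/
lemma exists_submatrix_span_eq_top {d k m : ℕ} (hk : 0 < k) (hm : k ≤ m)
    (Φ : Matrix (Fin d) (Fin k) ℝ)
    (hspan : Submodule.span ℝ (Set.range fun i : Fin d => Φ i) = ⊤) :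
    ∃ f : Fin m → Fin d,
      Submodule.span ℝ (Set.range fun a => Φ.submatrix f id a) = ⊤ := by
  obtain ⟨b, hb, hbspan, -⟩ :=
    Submodule.exists_fun_fin_finrank_span_eq ℝ (Set.range fun i : Fin d => Φ i)
  have hrank : Module.finrank ℝ (Submodule.span ℝ (Set.range fun i : Fin d => Φ i)) = k := by
    rw [hspan, finrank_top, Module.finrank_fin_fun]
  choose g hg using hb
  refine ⟨fun a => g (if h : a.1 < k then ⟨a.1, hrank.symm ▸ h⟩ else ⟨0, hrank.symm ▸ hk⟩), ?_⟩
  refine eq_top_iff.2 ((hbspan.trans hspan).ge.trans (Submodule.span_mono ?_))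
  rintro _ ⟨i, rfl⟩
  have hi : i.1 < k := i.2.trans_eq hrank
  refine ⟨⟨i.1, hi.trans_le hm⟩, ?_⟩
  have hgi := hg i
  ext j
  simpa [hi] using congrFun hgi j

/-- There is a design of `m ≥ k` rows, repetitions allowed, whose Gram matrix is invertible and for
which all leverages are at most `k / (m - k + 1)`. -/
lemma exists_submatrix_leverage_le {d k m : ℕ} (hk : 0 < k) (hm : k ≤ m)
    (Φ : Matrix (Fin d) (Fin k) ℝ)
    (hspan : Submodule.span ℝ (Set.range fun i : Fin d => Φ i) = ⊤) :
    ∃ f : Fin m → Fin d,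
      IsUnit ((Φ.submatrix f id)ᵀ * Φ.submatrix f id).det ∧
      ∀ i, ((m : ℝ) - k + 1) *
        (Φ i ⬝ᵥ (((Φ.submatrix f id)ᵀ * Φ.submatrix f id)⁻¹ *ᵥ Φ i)) ≤ k := by
  obtain ⟨f₀, hf₀⟩ := exists_submatrix_span_eq_top hk hm Φ hspan
  have : Nonempty (Fin m → Fin d) := ⟨f₀⟩
  obtain ⟨f, hf⟩ := Finite.exists_max fun f : Fin m → Fin d =>
    ((Φ.submatrix f id)ᵀ * Φ.submatrix f id).det
  have hpos := (det_transpose_mul_self_pos _ hf₀).trans_le (hf f₀)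
  refine ⟨f, hpos.ne'.isUnit, fun i => ?_⟩
  have hexchange := leverage_le_of_forall_exchange (Φ.submatrix f id) hpos (Φ i) fun a => by
    have hupdate : (Φ.submatrix f id).updateRow a (Φ i) =
        Φ.submatrix (Function.update f a i) id := by
      ext b j
      by_cases hb : b = a
      · subst hb; simp
      · simp [hb]
    rw [hupdate]
    exact hf _
  simpa using hexchange

/-- The empirical distribution of a finite sequence of indices. -/
noncomputable def empiricalWeight {d m : ℕ} (f : Fin m → Fin d) (i : Fin d) : ℝ :=
  ∑ a, if f a = i then (m : ℝ)⁻¹ else 0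

lemma sum_empiricalWeight_smul {d m : ℕ} {E : Type*} [AddCommGroup E] [Module ℝ E]
    (f : Fin m → Fin d) (x : Fin d → E) :
    ∑ i, empiricalWeight f i • x i = (m : ℝ)⁻¹ • ∑ a, x (f a) := by
  simp only [empiricalWeight, Finset.sum_smul, ite_smul, zero_smul]
  rw [Finset.sum_comm, Finset.smul_sum]
  simp

lemma designMatrix_empiricalWeight {d k m : ℕ} (Φ : Matrix (Fin d) (Fin k) ℝ)
    (f : Fin m → Fin d) :
    designMatrix Φ (empiricalWeight f) =
      (m : ℝ)⁻¹ • ((Φ.submatrix f id)ᵀ * Φ.submatrix f id) := by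
  rw [designMatrix, sum_empiricalWeight_smul, transpose_mul_self_eq_sum_vecMulVec]
  rfl

lemma ncard_pos_empiricalWeight_le {d m : ℕ} (f : Fin m → Fin d) :
    Set.ncard {i | 0 < empiricalWeight f i} ≤ m := by
  have hsub : {i | 0 < empiricalWeight f i} ⊆ Set.range f := by
    intro i hi
    have hi' : empiricalWeight f i ≠ 0 := ne_of_gt hi
    obtain ⟨a, -, ha⟩ := Finset.exists_ne_zero_of_sum_ne_zero hi'
    exact ⟨a, by_contra fun h => ha (if_neg h)⟩
  refine (Set.ncard_le_ncard hsub (Set.toFinite _)).trans ?_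
  rw [← Set.image_univ]
  simpa [Set.ncard_univ] using Set.ncard_image_le (f := f) Set.finite_univ

lemma one_half_le_log_log {x : ℝ} (hx : 9 ≤ x) : 1 / 2 ≤ Real.log (Real.log x) := by
  have hlog3 : 1 ≤ Real.log 3 := by
    rw [Real.le_log_iff_exp_le (by norm_num)]
    linarith [Real.exp_one_lt_d9]
  have hlogx : 2 ≤ Real.log x := by
    have h9 : Real.log 9 = 2 * Real.log 3 := by
      rw [show (9 : ℝ) = 3 ^ 2 by norm_num, Real.log_pow]
      norm_num
    linarith [Real.log_le_log (by norm_num) hx]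
  have hlog2 := Real.log_le_log (by norm_num) hlogx
  linarith [Real.log_two_gt_d9]

lemma two_mul_sub_two_le {k : ℕ} (hk : 3 ≤ k) :
    2 * (k : ℝ) - 2 ≤ 4 * k * Real.log (Real.log k) + 16 := by
  have hk' : (3 : ℝ) ≤ k := by exact_mod_cast hk
  rcases le_total (k : ℝ) 9 with h | h
  · have hlog : 1 ≤ Real.log k := by
      rw [Real.le_log_iff_exp_le (by linarith)]
      linarith [Real.exp_one_lt_d9]
    have := mul_nonneg (by linarith : (0 : ℝ) ≤ 4 * k) (Real.log_nonneg hlog)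
    linarith
  · nlinarith [one_half_le_log_log h]

theorem stmt0 (d k : ℕ) (hk : 3 ≤ k) (hd : k ≤ d)
    (Φ : Matrix (Fin d) (Fin k) ℝ)
    (hspan : Submodule.span ℝ (Set.range fun i : Fin d => Φ i) = ⊤) :
    ∃ ρ : Fin d → ℝ,
      (∀ i, 0 ≤ ρ i) ∧ (∑ i, ρ i = 1) ∧
      IsUnit (designMatrix Φ ρ) ∧
      (∀ i : Fin d, Φ i ⬝ᵥ ((designMatrix Φ ρ)⁻¹ *ᵥ Φ i) ≤ 2 * k) ∧
      ((Set.ncard {i : Fin d | 0 < ρ i} : ℝ) ≤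
        4 * k * Real.log (Real.log k) + 16) := by
  obtain ⟨f, hunit, hlev⟩ :=
    exists_submatrix_leverage_le (m := 2 * k - 2) (by omega) (by omega) Φ hspan
  have hk' : (3 : ℝ) ≤ k := by exact_mod_cast hk
  have hm : ((2 * k - 2 : ℕ) : ℝ) = 2 * k - 2 := by
    rw [Nat.cast_sub (by omega)]
    push_cast
    ring
  have hm0 : ((2 * k - 2 : ℕ) : ℝ) ≠ 0 := by
    rw [hm]
    linarith
  have hm0' : IsUnit ((2 * k - 2 : ℕ) : ℝ)⁻¹ := (inv_ne_zero hm0).isUnit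
  refine ⟨empiricalWeight f, fun i => ?_, ?_, ?_, fun i => ?_, ?_⟩
  · exact Finset.sum_nonneg fun a _ => by positivity
  · simpa [hm0] using sum_empiricalWeight_smul f fun _ => (1 : ℝ)
  · rw [designMatrix_empiricalWeight, Matrix.isUnit_iff_isUnit_det, Matrix.det_smul]
    exact (hm0'.pow _).mul hunit
  · have hinv : (designMatrix Φ (empiricalWeight f))⁻¹ =
        ((2 * k - 2 : ℕ) : ℝ) • ((Φ.submatrix f id)ᵀ * Φ.submatrix f id)⁻¹ := by
      rw [designMatrix_empiricalWeight]
      refine Matrix.inv_eq_left_inv ?_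
      rw [Matrix.smul_mul, Matrix.mul_smul, smul_smul, mul_inv_cancel₀ hm0, one_smul,
        Matrix.nonsing_inv_mul _ hunit]
    have h := hlev i
    rw [hinv, Matrix.smul_mulVec, dotProduct_smul, smul_eq_mul]
    rw [hm] at h ⊢
    linarith
  · have hcard : (Set.ncard {i | 0 < empiricalWeight f i} : ℝ) ≤ (2 * k - 2 : ℕ) := by
      exact_mod_cast ncard_pos_empiricalWeight_le f
    rw [hm] at hcard
    exact hcard.trans (two_mul_sub_two_le hk)
end

section
/- Let Φ ∈ ℝ^{d×k} have rows Φ_1,…,Φ_d spanning ℝ^k, and let ρ be a probability distribution on {1,…,d} such that G(ρ) is invertible and g(ρ) ≤ 2k. Suppose μ ∈ ℝ^d can be written μ = v + Δ where v lies in the column span of Φ (i.e., v = Φη₀ for some η₀ ∈ ℝ^k) and ‖Δ‖_∞ ≤ ε₀, and let η ∈ ℝ^d satisfy ‖η‖_∞ ≤ ε₁. Define θ̂ = G(ρ)^{-1} Σ_{i=1}^d ρ(i)·(μ(i) + η(i))·Φ_i. Then ‖Φθ̂ − μ‖_∞ ≤ ε₀ + (ε₀ + ε₁)·√(2k). -/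
open scoped BigOperators Matrix

theorem dotProduct_designMatrix_mulVec {d k : ℕ} (Φ : Matrix (Fin d) (Fin k) ℝ)
    (ρ : Fin d → ℝ) (x y : Fin k → ℝ) :
    x ⬝ᵥ (designMatrix Φ ρ *ᵥ y) = ∑ j, ρ j * ((Φ j ⬝ᵥ x) * (Φ j ⬝ᵥ y)) := by
  simp only [designMatrix, Matrix.sum_mulVec, dotProduct_sum, Matrix.smul_mulVec,
    Matrix.vecMulVec_mulVec, dotProduct_smul, smul_eq_mul, op_smul_eq_smul]
  exact Finset.sum_congr rfl fun j _ => by rw [dotProduct_comm x (Φ j)]; ring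

theorem dotProduct_designMatrix_mulVec_comm {d k : ℕ} (Φ : Matrix (Fin d) (Fin k) ℝ)
    (ρ : Fin d → ℝ) (x y : Fin k → ℝ) :
    x ⬝ᵥ (designMatrix Φ ρ *ᵥ y) = y ⬝ᵥ (designMatrix Φ ρ *ᵥ x) := by
  simp only [dotProduct_designMatrix_mulVec, mul_comm (Φ _ ⬝ᵥ x)]

/-- A weighted average of `c j * s j` with `|c j| ≤ ε` is at most `ε` times the weighted root mean
square of `s`. -/
theorem abs_sum_mul_mul_le_mul_sqrt {ι : Type*} [Fintype ι] {ρ c s : ι → ℝ} {ε B : ℝ}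
    (hρ0 : ∀ j, 0 ≤ ρ j) (hρ1 : ∑ j, ρ j = 1) (hε : 0 ≤ ε) (hc : ∀ j, |c j| ≤ ε)
    (hs : ∑ j, ρ j * s j ^ 2 ≤ B) :
    |∑ j, ρ j * (c j * s j)| ≤ ε * Real.sqrt B := by
  have hmean : (∑ j, ρ j * |s j|) ^ 2 ≤ B := by
    refine (Real.pow_arith_mean_le_arith_mean_pow Finset.univ ρ (fun j => |s j|)
      (fun j _ => hρ0 j) hρ1 (fun j _ => abs_nonneg _) 2).trans ?_
    simpa only [sq_abs] using hs
  calc |∑ j, ρ j * (c j * s j)| ≤ ∑ j, |ρ j * (c j * s j)| := Finset.abs_sum_le_sum_abs _ _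
    _ ≤ ∑ j, ε * (ρ j * |s j|) := Finset.sum_le_sum fun j _ => by
        rw [abs_mul, abs_mul, abs_of_nonneg (hρ0 j), mul_left_comm]
        exact mul_le_mul_of_nonneg_right (hc j) (mul_nonneg (hρ0 j) (abs_nonneg _))
    _ = ε * ∑ j, ρ j * |s j| := by rw [Finset.mul_sum]
    _ ≤ ε * Real.sqrt B := mul_le_mul_of_nonneg_left (Real.le_sqrt_of_sq_le hmean) hε

theorem stmt1 (d k : ℕ)
    (Φ : Matrix (Fin d) (Fin k) ℝ)
    (hspan : Submodule.span ℝ (Set.range fun i : Fin d => Φ i) = ⊤)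
    (ρ : Fin d → ℝ) (hρ0 : ∀ i, 0 ≤ ρ i) (hρ1 : ∑ i, ρ i = 1)
    (hG : IsUnit (designMatrix Φ ρ))
    (hg : ∀ i : Fin d, Φ i ⬝ᵥ ((designMatrix Φ ρ)⁻¹ *ᵥ Φ i) ≤ 2 * k)
    (μ Δ : Fin d → ℝ) (η₀ : Fin k → ℝ) (ε₀ ε₁ : ℝ)
    (hμ : μ = Φ *ᵥ η₀ + Δ) (hΔ : ∀ i, |Δ i| ≤ ε₀)
    (η : Fin d → ℝ) (hη : ∀ i, |η i| ≤ ε₁) :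
    ∀ i : Fin d,
      |(Φ *ᵥ ((designMatrix Φ ρ)⁻¹ *ᵥ
          (∑ j : Fin d, (ρ j * (μ j + η j)) • Φ j))) i - μ i| ≤
        ε₀ + (ε₀ + ε₁) * Real.sqrt (2 * k) := by
  intro i
  have hdet := (Matrix.isUnit_iff_isUnit_det _).mp hG
  have hinv (x : Fin k → ℝ) : designMatrix Φ ρ *ᵥ ((designMatrix Φ ρ)⁻¹ *ᵥ x) = x := by
    rw [Matrix.mulVec_mulVec, Matrix.mul_nonsing_inv _ hdet, Matrix.one_mulVec]
  set w := (designMatrix Φ ρ)⁻¹ *ᵥ Φ i with hw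
  have hε₀ : 0 ≤ ε₀ := (abs_nonneg _).trans (hΔ i)
  have hε₁ : 0 ≤ ε₁ := (abs_nonneg _).trans (hη i)
  have hestimate (x : Fin k → ℝ) : (Φ *ᵥ ((designMatrix Φ ρ)⁻¹ *ᵥ x)) i = w ⬝ᵥ x := by
    have h := dotProduct_designMatrix_mulVec_comm Φ ρ ((designMatrix Φ ρ)⁻¹ *ᵥ x) w
    rw [hinv, hw, hinv, dotProduct_comm] at h
    exact h
  have hexact : ∑ j, ρ j * ((Φ j ⬝ᵥ w) * (Φ j ⬝ᵥ η₀)) = Φ i ⬝ᵥ η₀ := by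
    rw [← dotProduct_designMatrix_mulVec, dotProduct_designMatrix_mulVec_comm, hw, hinv,
      dotProduct_comm]
  have hvar : ∑ j, ρ j * (Φ j ⬝ᵥ w) ^ 2 ≤ 2 * k := by
    simp only [sq]
    rw [← dotProduct_designMatrix_mulVec]
    nth_rewrite 2 [hw]
    rw [hinv, dotProduct_comm]
    exact hg i
  have hμ' (j : Fin d) : μ j = Φ j ⬝ᵥ η₀ + Δ j := congrFun hμ j
  have herror : (Φ *ᵥ ((designMatrix Φ ρ)⁻¹ *ᵥ ∑ j, (ρ j * (μ j + η j)) • Φ j)) i - μ i =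
      ∑ j, ρ j * ((Δ j + η j) * (Φ j ⬝ᵥ w)) - Δ i := by
    have hsplit : w ⬝ᵥ ∑ j, (ρ j * (μ j + η j)) • Φ j =
        ∑ j, ρ j * ((Φ j ⬝ᵥ w) * (Φ j ⬝ᵥ η₀)) + ∑ j, ρ j * ((Δ j + η j) * (Φ j ⬝ᵥ w)) := by
      rw [dotProduct_sum, ← Finset.sum_add_distrib]
      refine Finset.sum_congr rfl fun j _ => ?_
      rw [dotProduct_smul, smul_eq_mul, dotProduct_comm w, hμ' j]
      ring
    rw [hestimate, hsplit, hexact, hμ' i]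
    ring
  have hnoise := abs_sum_mul_mul_le_mul_sqrt hρ0 hρ1 (add_nonneg hε₀ hε₁)
    (fun j => (abs_add_le (Δ j) (η j)).trans (add_le_add (hΔ j) (hη j))) hvar
  rw [herror]
  linarith [abs_sub (∑ j, ρ j * ((Δ j + η j) * (Φ j ⬝ᵥ w))) (Δ i), hΔ i]
end

section
/- Let U be a k-dimensional linear subspace of ℝ^d with d ≥ k ≥ 3. Then there exist n ≤ 4k·log(log k) + 16 coordinates i_1,…,i_n ∈ {1,…,d} (natural logarithms) such that for all u, ū ∈ U: ‖u − ū‖_∞ ≤ √(2k) · max_{j∈[n]} |u(i_j) − ū(i_j)|. -/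
open scoped BigOperators

namespace Matrix

theorem mul_mul_transpose_apply {l m n p R : Type*} [Fintype m] [Fintype n]
    [NonUnitalSemiring R] (B : Matrix l m R) (A : Matrix m n R) (C : Matrix p n R) (i : l) (j : p) :
    (B * A * Cᵀ) i j = B i ⬝ᵥ A *ᵥ C j := by
  rw [Matrix.mul_assoc]
  rfl

theorem transpose_mul_self_updateRow {m n : Type*} [Fintype m] [DecidableEq m]
    (A : Matrix m n ℝ) (x : n → ℝ) (j : m) :
    (A.updateRow j x)ᵀ * A.updateRow j x =
      Aᵀ * A + (of ![A j, x])ᵀ * of ![-A j, x] := by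
  ext a b
  simp only [mul_apply, transpose_apply, Matrix.add_apply, Fin.sum_univ_two, of_apply, cons_val_zero,
    cons_val_one, Pi.neg_apply]
  rw [← Finset.add_sum_erase _ _ (Finset.mem_univ j),
    ← Finset.add_sum_erase _ (fun i => A i a * A i b) (Finset.mem_univ j)]
  have : ∑ i ∈ Finset.univ.erase j, A.updateRow j x i a * A.updateRow j x i b
      = ∑ i ∈ Finset.univ.erase j, A i a * A i b := by
    refine Finset.sum_congr rfl fun i hi => ?_
    rw [updateRow_ne (Finset.ne_of_mem_erase hi)]
  rw [this]
  simp only [updateRow_self]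
  ring

theorem det_transpose_mul_self_updateRow {m n : Type*} [Fintype m] [DecidableEq m]
    [Fintype n] [DecidableEq n] (A : Matrix m n ℝ) (hA : IsUnit (Aᵀ * A).det)
    (x : n → ℝ) (j : m) :
    ((A.updateRow j x)ᵀ * A.updateRow j x).det =
      (Aᵀ * A).det * ((1 - (A * (Aᵀ * A)⁻¹ * Aᵀ) j j) * (1 + x ⬝ᵥ (Aᵀ * A)⁻¹ *ᵥ x)
        + (A *ᵥ (Aᵀ * A)⁻¹ *ᵥ x) j ^ 2) := by
  have hG : ((Aᵀ * A)⁻¹)ᵀ = (Aᵀ * A)⁻¹ := by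
    rw [transpose_nonsing_inv, transpose_mul, transpose_transpose]
  rw [transpose_mul_self_updateRow, det_add_mul _ _ hA]
  generalize (Aᵀ * A)⁻¹ = G at *
  have hs : x ⬝ᵥ G *ᵥ A j = A j ⬝ᵥ G *ᵥ x := by
    rw [dotProduct_mulVec, dotProduct_comm, ← mulVec_transpose, hG]
  have hc : (A *ᵥ G *ᵥ x) j = A j ⬝ᵥ G *ᵥ x := rfl
  have h0 (y z : n → ℝ) : of ![y, z] 0 = y := rfl
  have h1 (y z : n → ℝ) : of ![y, z] 1 = z := rfl
  rw [det_fin_two, hc]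
  simp only [Matrix.add_apply, mul_mul_transpose_apply, one_apply_eq, h0, h1,
    neg_dotProduct, hs, ne_eq, zero_ne_one, one_ne_zero, not_false_eq_true, one_apply_ne]
  ring

theorem exists_vecMul_eq_of_det_updateRow_le {m n : Type*} [Fintype m] [DecidableEq m]
    [Fintype n] [DecidableEq n] (A : Matrix m n ℝ) (hA : 0 < (Aᵀ * A).det) (x : n → ℝ)
    (h : ∀ j, ((A.updateRow j x)ᵀ * A.updateRow j x).det ≤ (Aᵀ * A).det) :
    ∃ c : m → ℝ, c ᵥ* A = x ∧
      (∑ j, c j ^ 2) * (Fintype.card m - Fintype.card n + 1) ≤ Fintype.card n := by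
  have hu : IsUnit (Aᵀ * A).det := hA.ne'.isUnit
  have h1 : Aᵀ *ᵥ A *ᵥ (Aᵀ * A)⁻¹ *ᵥ x = x := by
    rw [mulVec_mulVec, mulVec_mulVec, mul_nonsing_inv _ hu, one_mulVec]
  have htr : ∑ j, (A * (Aᵀ * A)⁻¹ * Aᵀ) j j = Fintype.card n := by
    change trace _ = _
    rw [Matrix.mul_assoc, trace_mul_comm, Matrix.mul_assoc, nonsing_inv_mul _ hu, trace_one]
  have hb : ∑ j, (A *ᵥ (Aᵀ * A)⁻¹ *ᵥ x) j ^ 2 = x ⬝ᵥ (Aᵀ * A)⁻¹ *ᵥ x := by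
    have h2 (w : n → ℝ) : ∑ j, (A *ᵥ w) j ^ 2 = (Aᵀ *ᵥ A *ᵥ w) ⬝ᵥ w := by
      rw [mulVec_transpose, ← dotProduct_mulVec]
      simp only [dotProduct, sq]
    rw [h2, h1]
  refine ⟨A *ᵥ (Aᵀ * A)⁻¹ *ᵥ x, by rw [← mulVec_transpose, h1], ?_⟩
  have hj (j : m) : (1 - (A * (Aᵀ * A)⁻¹ * Aᵀ) j j) * (1 + x ⬝ᵥ (Aᵀ * A)⁻¹ *ᵥ x)
        + (A *ᵥ (Aᵀ * A)⁻¹ *ᵥ x) j ^ 2 ≤ 1 := by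
    have := h j
    rw [det_transpose_mul_self_updateRow A hu] at this
    exact le_of_mul_le_mul_left (by simpa using this) hA
  have hs := Finset.sum_le_sum fun j (_ : j ∈ Finset.univ) => hj j
  rw [Finset.sum_add_distrib, ← Finset.sum_mul, Finset.sum_sub_distrib, htr, hb] at hs
  rw [hb]
  simp at hs
  linarith

theorem exists_det_pos {d k n : ℕ} (hk : 0 < k) (hn : k ≤ n) (B : Matrix (Fin d) (Fin k) ℝ)
    (hB : B.rank = k) :
    ∃ f : Fin n → Fin d, 0 < ((B.submatrix f id)ᵀ * B.submatrix f id).det := by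
  obtain ⟨r, hr, -, hli⟩ := Submodule.exists_fun_fin_finrank_span_eq ℝ (Set.range B.row)
  have hrank := (rank_eq_finrank_span_row B).symm.trans hB
  generalize Module.finrank ℝ (Submodule.span ℝ (Set.range B.row)) = q at r hr hli hrank
  obtain rfl : k = q := hrank.symm
  choose g hg using hr
  have : Nonempty (Fin k) := ⟨⟨0, hk⟩⟩
  have hinv := Function.leftInverse_invFun (Fin.castLE_injective hn)
  have hu : IsUnit (B.submatrix g id) := by
    rw [← linearIndependent_rows_iff_isUnit]
    rwa [show (B.submatrix g id).row = r from funext hg]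
  have hinj := mulVec_injective_iff_isUnit.mpr hu
  refine ⟨g ∘ Function.invFun (Fin.castLE hn), ?_⟩
  have := (PosDef.conjTranspose_mul_self
    (B.submatrix (g ∘ Function.invFun (Fin.castLE hn)) id) fun v w hvw => hinj ?_).det_pos
  · simpa using this
  · funext i
    have := congrFun hvw (Fin.castLE hn i)
    simpa [mulVec, submatrix, hinv i] using this

theorem exists_rows_sum_sq_le {d k n : ℕ} (hk : 0 < k) (hn : k ≤ n) (B : Matrix (Fin d) (Fin k) ℝ)
    (hB : B.rank = k) :
    ∃ f : Fin n → Fin d, ∀ i, ∃ c : Fin n → ℝ, c ᵥ* B.submatrix f id = B i ∧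
      (∑ j, c j ^ 2) * (n - k + 1) ≤ k := by
  obtain ⟨f₀, hf₀⟩ := exists_det_pos hk hn B hB
  have : Nonempty (Fin n → Fin d) := ⟨f₀⟩
  obtain ⟨f, hf⟩ := Finite.exists_max fun f : Fin n → Fin d =>
    ((B.submatrix f id)ᵀ * B.submatrix f id).det
  refine ⟨f, fun i => ?_⟩
  have := exists_vecMul_eq_of_det_updateRow_le (B.submatrix f id) (hf₀.trans_le (hf f₀)) (B i)
    fun j => by
      have hupd : (B.submatrix f id).updateRow j (B i) =
          B.submatrix (Function.update f j i) id := by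
        ext a b
        by_cases h : a = j
        · subst h; simp
        · simp [h]
      rw [hupd]
      exact hf _
  simpa using this

end Matrix

open scoped Matrix

theorem two_mul_le_four_mul_log_log_add (k : ℕ) (hk : 3 ≤ k) :
    2 * (k : ℝ) ≤ 4 * k * Real.log (Real.log k) + 16 := by
  have hk0 : (0 : ℝ) < k := by positivity
  rcases le_or_gt k 8 with h8 | h9
  · have h1 : Real.exp 1 ≤ k := by
      have : (3 : ℝ) ≤ k := by exact_mod_cast hk
      linarith [Real.exp_one_lt_d9]
    have h2 : 1 ≤ Real.log k := (Real.le_log_iff_exp_le hk0).mpr h1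
    have h3 := Real.log_nonneg h2
    have h4 : (k : ℝ) ≤ 8 := by exact_mod_cast h8
    have : 0 ≤ 4 * k * Real.log (Real.log k) := by positivity
    linarith
  · have he := Real.exp_one_lt_d9
    have h9' : (9 : ℝ) ≤ k := by exact_mod_cast h9
    have h2 : 2 ≤ Real.log k := by
      rw [Real.le_log_iff_exp_le hk0, show (2 : ℝ) = 1 + 1 by norm_num, Real.exp_add]
      nlinarith [Real.exp_pos 1]
    have h3 : 1 / 2 ≤ Real.log (Real.log k) := by
      rw [Real.le_log_iff_exp_le (by linarith)]
      refine le_trans ?_ h2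
      have : Real.exp (1 / 2) * Real.exp (1 / 2) = Real.exp 1 := by
        rw [← Real.exp_add]; norm_num
      nlinarith [Real.exp_pos (1 / 2)]
    nlinarith

theorem stmt2 (d k : ℕ) (hk : 3 ≤ k) (hd : k ≤ d)
    (U : Submodule ℝ (Fin d → ℝ)) (hU : Module.finrank ℝ U = k) :
    ∃ (n : ℕ) (hn : 0 < n) (idx : Fin n → Fin d),
      ((n : ℝ) ≤ 4 * k * Real.log (Real.log k) + 16) ∧
      ∀ u ∈ U, ∀ v ∈ U, ∀ i : Fin d,
        |u i - v i| ≤ Real.sqrt (2 * k) *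
          (Finset.univ.sup' (Finset.univ_nonempty_iff.mpr ⟨⟨0, hn⟩⟩)
            fun j : Fin n => |u (idx j) - v (idx j)|) := by
  have hk0 : 0 < k := by omega
  have hkn : k ≤ 2 * k := by omega
  let b := Module.finBasisOfFinrankEq ℝ U hU
  let B : Matrix (Fin d) (Fin k) ℝ := Matrix.of fun i a => (b a : Fin d → ℝ) i
  have hB : B.rank = k := by
    have hli : LinearIndependent ℝ (Matrix.row Bᵀ) :=
      b.linearIndependent.map' U.subtype U.ker_subtype
    rw [← Matrix.rank_transpose, hli.rank_matrix, Fintype.card_fin]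
  obtain ⟨f, hf⟩ := Matrix.exists_rows_sum_sq_le hk0 hkn B hB
  refine ⟨2 * k, by omega, f, ?_, fun u hu v hv i => ?_⟩
  · exact_mod_cast two_mul_le_four_mul_log_log_add k hk
  have hw := U.sub_mem hu hv
  set w := u - v
  obtain ⟨c, hc, hc2⟩ := hf i
  have hwB : w = B *ᵥ b.repr ⟨w, hw⟩ := by
    have := congrArg (Subtype.val) (b.sum_repr ⟨w, hw⟩)
    ext l
    refine (congrFun this l).symm.trans ?_
    simp only [AddSubmonoidClass.coe_finsetSum, Submodule.coe_smul, Finset.sum_apply, Pi.smul_apply,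
      smul_eq_mul, B, Matrix.mulVec, dotProduct, Matrix.of_apply, mul_comm]
  have hwi : w i = ∑ j, c j * w (f j) := by
    have h1 : w i = B i ⬝ᵥ b.repr ⟨w, hw⟩ := congrFun hwB i
    have h2 (j) : w (f j) = (B.submatrix f id *ᵥ b.repr ⟨w, hw⟩) j := congrFun hwB (f j)
    rw [h1, ← hc, ← Matrix.dotProduct_mulVec]
    simp only [h2, dotProduct]
  have hle (j : Fin (2 * k)) := Finset.le_sup' (fun j => |u (f j) - v (f j)|) (Finset.mem_univ j)
  have h0 := (abs_nonneg _).trans (hle ⟨0, by omega⟩)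
  set S := Finset.univ.sup' _ fun j => |u (f j) - v (f j)|
  have hsum : (∑ j, |c j|) ≤ Real.sqrt (2 * k) := by
    refine Real.le_sqrt_of_sq_le ?_
    have h3 := sq_sum_le_card_mul_sum_sq (s := Finset.univ) (f := fun j => |c j|)
    simp only [sq_abs, Finset.card_univ, Fintype.card_fin] at h3
    push_cast at h3 hc2
    have : 0 ≤ ∑ j, c j ^ 2 := by positivity
    nlinarith
  calc |u i - v i| = |∑ j, c j * w (f j)| := by rw [← hwi]; rfl
    _ ≤ ∑ j, |c j| * S := (Finset.abs_sum_le_sum_abs _ _).trans <|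
        Finset.sum_le_sum fun j _ => by
          rw [abs_mul]
          exact mul_le_mul_of_nonneg_left (hle j) (abs_nonneg _)
    _ = (∑ j, |c j|) * S := (Finset.sum_mul ..).symm
    _ ≤ _ := mul_le_mul_of_nonneg_right hsum h0
end

section
/- There exists a universal constant C > 0 with the following property. Let M ≥ 1, let w, ŵ ∈ ℝ_{≥0}^M satisfy Σ_{m=1}^M w_m = Σ_{m=1}^M ŵ_m = 1, let ν_1,…,ν_M, ν̂_1,…,ν̂_M ∈ [0,1], and let δ > 0. If |Σ_{m=1}^M w_m ν_m^d − Σ_{m=1}^M ŵ_m ν̂_m^d| < δ for every d = 1, 2, …, 2M−1, then there exists a coupling Γ of w and ŵ with Σ_{(m,m')∈[M]²} Γ(m,m')·|ν_m − ν̂_{m'}| ≤ C·M·δ^{1/(2M−1)}. -/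
open scoped BigOperators

open Finset in
/-- The monotone (north-west corner) coupling of two mass distributions on an ordered sequence of
points of the line, whose cost is controlled by the differences of the cumulative masses. -/
theorem exists_monotone_coupling (n : ℕ) (x a b : ℕ → ℝ) (hx : Monotone x)
    (ha : ∀ i, 0 ≤ a i) (hb : ∀ i, 0 ≤ b i)
    (hab : ∑ i ∈ range (n + 1), a i = ∑ i ∈ range (n + 1), b i) :
    ∃ G : ℕ → ℕ → ℝ, (∀ i j, 0 ≤ G i j) ∧
      (∀ i ∈ range (n + 1), ∑ j ∈ range (n + 1), G i j = a i) ∧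
      (∀ j ∈ range (n + 1), ∑ i ∈ range (n + 1), G i j = b j) ∧
      ∑ i ∈ range (n + 1), ∑ j ∈ range (n + 1), G i j * |x i - x j| ≤
        ∑ r ∈ range n, |∑ i ∈ range (r + 1), (a i - b i)| * (x (r + 1) - x r) := by
  set A : ℕ → ℝ := fun k => ∑ i ∈ range k, a i with hA
  set B : ℕ → ℝ := fun k => ∑ i ∈ range k, b i with hB
  have hAm : Monotone A := fun i j hij =>
    sum_le_sum_of_subset_of_nonneg (range_mono hij) fun k _ _ => ha k
  have hBm : Monotone B := fun i j hij =>
    sum_le_sum_of_subset_of_nonneg (range_mono hij) fun k _ _ => hb k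
  have hA0 : A 0 = 0 := by simp [hA]
  have hB0 : B 0 = 0 := by simp [hB]
  have hAB : A (n + 1) = B (n + 1) := hab
  have hAs : ∀ i, A (i + 1) - A i = a i := fun i => by simp [hA, sum_range_succ]
  have hBs : ∀ i, B (i + 1) - B i = b i := fun i => by simp [hB, sum_range_succ]
  have hAnn : ∀ i, 0 ≤ A i := fun i => sum_nonneg fun k _ => ha k
  have hBnn : ∀ i, 0 ≤ B i := fun i => sum_nonneg fun k _ => hb k
  set G : ℕ → ℕ → ℝ := fun i j =>
    (min (A (i + 1)) (B (j + 1)) - min (A i) (B (j + 1))) -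
      (min (A (i + 1)) (B j) - min (A i) (B j)) with hG
  have hGj : ∀ i k, ∑ j ∈ range k, G i j = min (A (i + 1)) (B k) - min (A i) (B k) := by
    intro i k
    rw [hG, sum_range_sub (fun j => min (A (i + 1)) (B j) - min (A i) (B j)) k, hB0,
      min_eq_right (hAnn _), min_eq_right (hAnn _)]
    ring
  have hGij : ∀ k l, ∑ i ∈ range k, ∑ j ∈ range l, G i j = min (A k) (B l) := by
    intro k l
    simp_rw [hGj]
    rw [sum_range_sub (fun i => min (A i) (B l)) k, hA0, min_eq_left (hBnn _), sub_zero]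
  have hrow : ∀ i ∈ range (n + 1), ∑ j ∈ range (n + 1), G i j = a i := by
    intro i hi
    have hi := mem_range.1 hi
    rw [hGj, ← hAB, min_eq_left (hAm (by omega)), min_eq_left (hAm (by omega)), hAs]
  have hcol : ∀ j ∈ range (n + 1), ∑ i ∈ range (n + 1), G i j = b j := by
    intro j hj
    have hj := mem_range.1 hj
    have h1 := hGij (n + 1) (j + 1)
    have h2 := hGij (n + 1) j
    simp_rw [sum_range_succ _ j, sum_add_distrib] at h1
    rw [h2, hAB, min_eq_right (hBm (by omega)), min_eq_right (hBm (by omega))] at h1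
    linarith [hBs j]
  refine ⟨G, ?_, hrow, hcol, ?_⟩
  · intro i j
    have h1 := hAm (Nat.le_succ i)
    have h2 := hBm (Nat.le_succ j)
    simp only [hG, Nat.succ_eq_add_one] at *
    rcases le_total (A (i + 1)) (B (j + 1)) with h3 | h3 <;>
    rcases le_total (A i) (B (j + 1)) with h4 | h4 <;>
    rcases le_total (A (i + 1)) (B j) with h5 | h5 <;>
    rcases le_total (A i) (B j) with h6 | h6 <;>
    simp only [min_eq_left, min_eq_right, h3, h4, h5, h6] <;> linarith
  · have hdist : ∀ i ∈ range (n + 1), ∀ j ∈ range (n + 1), |x i - x j| =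
        ∑ r ∈ range n, ((if i < r + 1 then 1 else 0) + (if j < r + 1 then 1 else 0) -
          2 * (if i < r + 1 then if j < r + 1 then 1 else 0 else 0)) * (x (r + 1) - x r) := by
      have key : ∀ i j, i ≤ j → j < n + 1 → x j - x i =
          ∑ r ∈ range n, ((if i < r + 1 then 1 else 0) + (if j < r + 1 then 1 else 0) -
          2 * (if i < r + 1 then if j < r + 1 then 1 else 0 else 0)) * (x (r + 1) - x r) := by
        intro i j hij hj
        rw [← sum_Ico_sub x hij]
        have : Ico i j = (range n).filter (fun r => i ≤ r ∧ r < j) := by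
          ext r; simp only [mem_Ico, mem_filter, mem_range]; omega
        rw [this, sum_filter]
        refine sum_congr rfl fun r _ => ?_
        split_ifs <;> first | omega | ring
      intro i hi j hj
      rcases le_total i j with h | h
      · rw [abs_of_nonpos (sub_nonpos.2 (hx h)), neg_sub, key i j h (mem_range.1 hj)]
      · rw [abs_of_nonneg (sub_nonneg.2 (hx h)), key j i h (mem_range.1 hi)]
        refine sum_congr rfl fun r _ => ?_
        split_ifs <;> ring
    have hcut : ∀ r ∈ range n, ∑ i ∈ range (n + 1), ∑ j ∈ range (n + 1),
        G i j * ((if i < r + 1 then 1 else 0) + (if j < r + 1 then 1 else 0) -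
          2 * (if i < r + 1 then if j < r + 1 then 1 else 0 else 0)) =
        |∑ i ∈ range (r + 1), (a i - b i)| := by
      intro r hr
      have hr := mem_range.1 hr
      have hfil : ∀ f : ℕ → ℝ, ∑ i ∈ range (n + 1), (if i < r + 1 then f i else 0) =
          ∑ i ∈ range (r + 1), f i := by
        intro f
        rw [← sum_filter]
        congr 1
        ext i; simp only [mem_filter, mem_range]; omega
      have e1 : ∑ i ∈ range (n + 1), ∑ j ∈ range (n + 1),
          G i j * (if i < r + 1 then 1 else 0) = A (r + 1) := by
        simp_rw [← sum_mul]
        rw [sum_congr rfl fun i hi => by rw [hrow i hi]]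
        simp only [mul_ite, mul_one, mul_zero]
        exact hfil a
      have e2 : ∑ i ∈ range (n + 1), ∑ j ∈ range (n + 1),
          G i j * (if j < r + 1 then 1 else 0) = B (r + 1) := by
        rw [sum_comm]
        simp_rw [← sum_mul]
        rw [sum_congr rfl fun i hi => by rw [hcol i hi]]
        simp only [mul_ite, mul_one, mul_zero]
        exact hfil b
      have e3 : ∑ i ∈ range (n + 1), ∑ j ∈ range (n + 1),
          G i j * (if i < r + 1 then if j < r + 1 then 1 else 0 else 0) =
          min (A (r + 1)) (B (r + 1)) := by
        rw [← hGij, ← hfil]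
        refine sum_congr rfl fun i _ => ?_
        split_ifs
        · simp only [mul_ite, mul_one, mul_zero]
          exact hfil (G i)
        · simp
      have e4 : ∑ i ∈ range (r + 1), (a i - b i) = A (r + 1) - B (r + 1) := sum_sub_distrib _ _
      rw [e4]
      simp_rw [mul_sub, mul_add, mul_left_comm _ (2 : ℝ), sum_sub_distrib, sum_add_distrib,
        ← mul_sum]
      rw [e1, e2, e3]
      rcases le_total (A (r + 1)) (B (r + 1)) with h | h
      · rw [min_eq_left h, abs_of_nonpos (sub_nonpos.2 h)]; ring
      · rw [min_eq_right h, abs_of_nonneg (sub_nonneg.2 h)]; ring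
    refine le_of_eq ?_
    rw [sum_congr rfl fun i hi => sum_congr rfl fun j hj => by rw [hdist i hi j hj, mul_sum]]
    rw [sum_congr rfl fun i _ => sum_comm, sum_comm]
    refine sum_congr rfl fun r hr => ?_
    rw [← hcut r hr, sum_mul]
    simp_rw [sum_mul, mul_assoc]

open Polynomial in
/-- Neville interpolation of a step function at nodes `x i ≤ … ≤ x (i + d)` of the unit interval
separated by a gap between `x r` and `x (r + 1)`. The coefficient bound is expressed by duality
with linear functionals. -/
theorem exists_step_interpolant (x : ℕ → ℝ) (hx : Monotone x) (h0 : ∀ i, 0 ≤ x i)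
    (h1 : ∀ i, x i ≤ 1) (r : ℕ) (hr : x r < x (r + 1)) (d i : ℕ) :
    ∃ P : ℝ[X], (∀ k, i ≤ k → k ≤ i + d → P.eval (x k) = if k ≤ r then 1 else 0) ∧
      ∀ (φ : ℝ[X] →ₗ[ℝ] ℝ) (δ : ℝ), (∀ k ≤ d, |φ (X ^ k)| ≤ δ) →
        |φ P| ≤ (4 / (x (r + 1) - x r)) ^ d * δ := by
  have hg : 0 < x (r + 1) - x r := sub_pos.2 hr
  have hg1 : 1 ≤ 4 / (x (r + 1) - x r) := by
    rw [one_le_div hg]; linarith [h0 r, h1 (r + 1)]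
  induction d generalizing i with
  | zero =>
    refine ⟨C (if i ≤ r then 1 else 0), fun k hk hk' => ?_, fun φ δ hφ => ?_⟩
    · rw [show k = i by omega, eval_C]
    · have h := hφ 0 le_rfl
      rw [pow_zero] at h
      rw [pow_zero, one_mul]
      split_ifs
      · simpa using h
      · simpa using (abs_nonneg _).trans h
  | succ d ih =>
    by_cases hid : i + (d + 1) ≤ r
    · refine ⟨1, fun k _ hk => by simp [hk.trans hid], fun φ δ hφ => ?_⟩
      have h := hφ 0 (Nat.zero_le _)
      rw [pow_zero] at h
      exact h.trans (le_mul_of_one_le_left ((abs_nonneg _).trans h) (one_le_pow₀ hg1))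
    by_cases hir : r < i
    · refine ⟨0, fun k hk _ => by simp [hir.trans_le hk], fun φ δ hφ => ?_⟩
      have h := (abs_nonneg _).trans (hφ 0 (Nat.zero_le _))
      rw [map_zero, abs_zero]
      positivity
    push Not at hid hir
    obtain ⟨P, hP, hPφ⟩ := ih i
    obtain ⟨Q, hQ, hQφ⟩ := ih (i + 1)
    set u := x i
    set v := x (i + (d + 1))
    have hu : u ≤ x r := hx hir
    have hv : x (r + 1) ≤ v := hx hid
    have huv : 0 < v - u := by linarith
    refine ⟨C (v - u)⁻¹ * ((C v - X) * P + (X - C u) * Q), fun k hk hk' => ?_,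
      fun φ δ hφ => ?_⟩
    · simp only [eval_mul, eval_C, eval_add, eval_sub, eval_X]
      rw [inv_mul_eq_iff_eq_mul₀ huv.ne']
      rcases hk.eq_or_lt with rfl | hlt
      · rw [hP _ le_rfl (by omega)]
        simp only [u]; ring
      rcases hk'.eq_or_lt with rfl | hlt'
      · rw [hQ _ hlt (by omega)]
        simp only [v]; ring
      · rw [hP k hk (by omega), hQ k hlt (by omega)]
        ring
    · have hδ : 0 ≤ δ := (abs_nonneg _).trans (hφ 0 (Nat.zero_le _))
      have h2 : ∀ t, 0 ≤ t → t ≤ 1 → ∀ k ≤ d,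
          |(φ.comp (LinearMap.mulLeft ℝ (C t - X))) (X ^ k)| ≤ 2 * δ := by
        intro t ht0 ht1 k hk
        have e : (φ.comp (LinearMap.mulLeft ℝ (C t - X))) (X ^ k) =
            t * φ (X ^ k) - φ (X ^ (k + 1)) := by
          simp only [LinearMap.comp_apply, LinearMap.mulLeft_apply]
          rw [sub_mul, map_sub, ← smul_eq_C_mul, map_smul, smul_eq_mul, pow_succ']
        rw [e]
        have a1 := hφ k (by omega)
        have a2 := hφ (k + 1) (by omega)
        have a3 : |t * φ (X ^ k)| ≤ δ := by
          rw [abs_mul, abs_of_nonneg ht0]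
          exact (mul_le_of_le_one_left (abs_nonneg _) ht1).trans a1
        exact (abs_sub _ _).trans (by linarith)
      have hp := hPφ _ _ (h2 v (h0 _) (h1 _))
      have hq := hQφ _ _ (h2 u (h0 _) (h1 _))
      simp only [LinearMap.comp_apply, LinearMap.mulLeft_apply] at hp hq
      have e : φ (C (v - u)⁻¹ * ((C v - X) * P + (X - C u) * Q)) =
          (v - u)⁻¹ * (φ ((C v - X) * P) - φ ((C u - X) * Q)) := by
        rw [← smul_eq_C_mul, map_smul, smul_eq_mul, ← map_sub]
        congr 2
        ring
      rw [e, abs_mul, abs_of_pos (inv_pos.2 huv)]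
      have hle : (v - u)⁻¹ ≤ (x (r + 1) - x r)⁻¹ := inv_anti₀ hg (by linarith)
      calc _ ≤ (x (r + 1) - x r)⁻¹ * ((4 / (x (r + 1) - x r)) ^ d * (2 * δ) +
            (4 / (x (r + 1) - x r)) ^ d * (2 * δ)) :=
            mul_le_mul hle ((abs_sub _ _).trans (add_le_add hp hq)) (abs_nonneg _)
              (inv_nonneg.2 hg.le)
        _ = _ := by rw [pow_succ, div_eq_mul_inv 4]; ring

open Finset Polynomial in
/-- If the first `n` moments of a signed measure of total mass zero on `n + 1` points of the unit
interval are small, then so are its cumulative masses, relative to the gaps between the points. -/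
theorem abs_cumulative_mul_gap_pow_le (n : ℕ) (x c : ℕ → ℝ) (hx : Monotone x) (h0 : ∀ i, 0 ≤ x i)
    (h1 : ∀ i, x i ≤ 1) (δ : ℝ)
    (hc : ∀ d ≤ n, |∑ i ∈ range (n + 1), c i * x i ^ d| ≤ δ) (r : ℕ) (hr : r < n)
    (hgap : x r < x (r + 1)) :
    |∑ i ∈ range (r + 1), c i| * (x (r + 1) - x r) ^ n ≤ 4 ^ n * δ := by
  have hg : 0 < x (r + 1) - x r := sub_pos.2 hgap
  obtain ⟨P, hP, hPφ⟩ := exists_step_interpolant x hx h0 h1 r hgap n 0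
  let φ : ℝ[X] →ₗ[ℝ] ℝ := ∑ i ∈ range (n + 1), c i • Polynomial.leval (x i)
  have hφ : ∀ Q, φ Q = ∑ i ∈ range (n + 1), c i * Q.eval (x i) := fun Q => by
    simp [φ, LinearMap.sum_apply]
  have h := hPφ φ δ fun k hk => by
    rw [hφ]
    simpa using hc k hk
  have e : φ P = ∑ i ∈ range (r + 1), c i := by
    rw [hφ, sum_congr rfl fun i hi => by
      rw [hP i (Nat.zero_le _) (by have := mem_range.1 hi; omega)]]
    simp only [mul_ite, mul_one, mul_zero]
    rw [← sum_filter]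
    congr 1
    ext i; simp only [mem_filter, mem_range]; omega
  rw [e, div_pow, div_mul_eq_mul_div, le_div_iff₀ (pow_pos hg n)] at h
  exact h

open Finset in
/-- The transport bound for two distributions supported on a common sequence of `n + 1` points. -/
theorem exists_coupling_le_of_moments (n : ℕ) (hn : n ≠ 0) (x a b : ℕ → ℝ) (hx : Monotone x)
    (h0 : ∀ i, 0 ≤ x i) (h1 : ∀ i, x i ≤ 1) (ha : ∀ i, 0 ≤ a i) (hb : ∀ i, 0 ≤ b i)
    (ha1 : ∑ i ∈ range (n + 1), a i = 1) (hb1 : ∑ i ∈ range (n + 1), b i = 1)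
    (δ : ℝ) (hδ : 0 < δ)
    (hm : ∀ d, 1 ≤ d → d ≤ n →
      |∑ i ∈ range (n + 1), a i * x i ^ d - ∑ i ∈ range (n + 1), b i * x i ^ d| < δ) :
    ∃ G : ℕ → ℕ → ℝ, (∀ i j, 0 ≤ G i j) ∧
      (∀ i ∈ range (n + 1), ∑ j ∈ range (n + 1), G i j = a i) ∧
      (∀ j ∈ range (n + 1), ∑ i ∈ range (n + 1), G i j = b j) ∧
      ∑ i ∈ range (n + 1), ∑ j ∈ range (n + 1), G i j * |x i - x j| ≤
        n * (4 * δ ^ ((1 : ℝ) / n)) := by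
  obtain ⟨G, hG, hrow, hcol, hcost⟩ := exists_monotone_coupling n x a b hx ha hb (ha1.trans hb1.symm)
  refine ⟨G, hG, hrow, hcol, hcost.trans ?_⟩
  have hε : 0 ≤ δ ^ ((1 : ℝ) / n) := Real.rpow_nonneg hδ.le _
  have hεn : (δ ^ ((1 : ℝ) / n)) ^ n = δ := by
    rw [one_div]; exact Real.rpow_inv_natCast_pow hδ.le hn
  have hterm : ∀ r ∈ range n, |∑ i ∈ range (r + 1), (a i - b i)| * (x (r + 1) - x r) ≤
      4 * δ ^ ((1 : ℝ) / n) := by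
    intro r hr
    have hr := mem_range.1 hr
    rcases (hx (Nat.le_succ r)).eq_or_lt with heq | hgap
    · rw [← Nat.succ_eq_add_one, ← heq, sub_self, mul_zero]
      positivity
    have hg : 0 < x (r + 1) - x r := sub_pos.2 hgap
    have hS := abs_cumulative_mul_gap_pow_le n x (fun i => a i - b i) hx h0 h1 δ (fun d hd => by
      simp_rw [sub_mul, sum_sub_distrib]
      rcases Nat.eq_zero_or_pos d with rfl | hd0
      · simpa [ha1, hb1] using hδ.le
      · exact (hm d hd0 hd).le) r hr hgap
    have hpart : ∀ f : ℕ → ℝ, (∀ i, 0 ≤ f i) → ∑ i ∈ range (n + 1), f i = 1 →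
        0 ≤ ∑ i ∈ range (r + 1), f i ∧ ∑ i ∈ range (r + 1), f i ≤ 1 := fun f hf hf1 =>
      ⟨sum_nonneg fun i _ => hf i, hf1 ▸ sum_le_sum_of_subset_of_nonneg
        (range_mono (by omega)) fun i _ _ => hf i⟩
    have hS1 : |∑ i ∈ range (r + 1), (a i - b i)| ≤ 1 := by
      rw [sum_sub_distrib, abs_le]
      have := hpart a ha ha1
      have := hpart b hb hb1
      constructor <;> linarith
    refine le_of_pow_le_pow_left₀ hn (by positivity) ?_
    rw [mul_pow, mul_pow, hεn]
    exact (mul_le_mul_of_nonneg_right (pow_le_of_le_one (abs_nonneg _) hS1 hn)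
      (pow_nonneg hg.le n)).trans hS
  simpa using sum_le_sum hterm

theorem stmt4 :
    ∃ C : ℝ, 0 < C ∧
      ∀ (M : ℕ), 1 ≤ M →
      ∀ (w wh : Fin M → ℝ), (∀ m, 0 ≤ w m) → (∀ m, 0 ≤ wh m) →
        (∑ m, w m = 1) → (∑ m, wh m = 1) →
      ∀ (ν νh : Fin M → ℝ),
        (∀ m, ν m ∈ Set.Icc (0 : ℝ) 1) → (∀ m, νh m ∈ Set.Icc (0 : ℝ) 1) →
      ∀ δ : ℝ, 0 < δ →
        (∀ d : ℕ, 1 ≤ d → d ≤ 2 * M - 1 →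
          |∑ m, w m * ν m ^ d - ∑ m, wh m * νh m ^ d| < δ) →
        ∃ Γ : Fin M → Fin M → ℝ,
          (∀ m m', 0 ≤ Γ m m') ∧
          (∀ m, ∑ m', Γ m m' = w m) ∧
          (∀ m', ∑ m, Γ m m' = wh m') ∧
          ∑ m, ∑ m', Γ m m' * |ν m - νh m'| ≤
            C * M * δ ^ ((1 : ℝ) / (2 * M - 1)) := by
  refine ⟨8, by norm_num, ?_⟩
  intro M hM w wh hw hwh hw1 hwh1 ν νh hν hνh δ hδ hm
  obtain ⟨n, hn⟩ : ∃ n, M + M = n + 1 := ⟨M + M - 1, by omega⟩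
  let e₀ : Fin (n + 1) ≃ Fin M ⊕ Fin M := (finCongr hn.symm).trans finSumFinEquiv.symm
  let y : Fin M ⊕ Fin M → ℝ := Sum.elim ν νh
  let e : Fin (n + 1) ≃ Fin M ⊕ Fin M := (Tuple.sort (y ∘ e₀)).trans e₀
  have hmono : Monotone (y ∘ e) := Tuple.monotone_sort (y ∘ e₀)
  let cl : ℕ → Fin M ⊕ Fin M := fun i => e (Fin.clamp i n)
  have hcl : ∀ i : Fin (n + 1), cl i = e i := fun i => by
    simp only [cl]
    congr 1
    ext
    simp [Fin.clamp]
    omega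
  let a : Fin M ⊕ Fin M → ℝ := Sum.elim w 0
  let b : Fin M ⊕ Fin M → ℝ := Sum.elim 0 wh
  have hsum : ∀ f : Fin M ⊕ Fin M → ℝ,
      ∑ i ∈ Finset.range (n + 1), f (cl i) = ∑ m, f (.inl m) + ∑ m, f (.inr m) := by
    intro f
    rw [← Fin.sum_univ_eq_sum_range (fun i => f (cl i)), ← Fintype.sum_sum_type]
    simp_rw [hcl]
    exact e.sum_comp f
  have hy : ∀ s, y s ∈ Set.Icc (0 : ℝ) 1 := by
    rintro (m | m)
    exacts [hν m, hνh m]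
  obtain ⟨G, hG, hrow, hcol, hcost⟩ := exists_coupling_le_of_moments n (by omega)
    (fun i => y (cl i)) (fun i => a (cl i)) (fun i => b (cl i))
    (fun i j hij => hmono (by
      rw [Fin.le_def]
      simp [Fin.clamp]
      omega))
    (fun i => (hy _).1) (fun i => (hy _).2)
    (fun i => by rcases cl i with m | m <;> simp [a, hw])
    (fun i => by rcases cl i with m | m <;> simp [b, hwh])
    (by rw [hsum a]; simp [a, hw1]) (by rw [hsum b]; simp [b, hwh1]) δ hδ
    (fun d hd1 hd => by
      rw [hsum fun s => a s * y s ^ d, hsum fun s => b s * y s ^ d]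
      simpa [a, b, y] using hm d hd1 (by omega))
  let K : Fin M ⊕ Fin M → Fin M ⊕ Fin M → ℝ := fun s t => G (e.symm s) (e.symm t)
  have hK : ∀ s t, 0 ≤ K s t := fun s t => hG _ _
  have hclK : ∀ s, cl (e.symm s) = s := fun s => by rw [hcl, e.apply_symm_apply]
  have hre : ∀ f : ℕ → ℝ, ∑ i ∈ Finset.range (n + 1), f i = ∑ s, f (e.symm s) := fun f => by
    rw [← Fin.sum_univ_eq_sum_range]
    exact (e.symm.sum_comp fun i : Fin (n + 1) => f i).symm
  have hKrow : ∀ s, ∑ t, K s t = a s := fun s => by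
    have h := hrow (e.symm s) (Finset.mem_range.2 (e.symm s).2)
    rwa [hre, hclK] at h
  have hKcol : ∀ t, ∑ s, K s t = b t := fun t => by
    have h := hcol (e.symm t) (Finset.mem_range.2 (e.symm t).2)
    rwa [hre, hclK] at h
  have hKl : ∀ s m, K s (.inl m) = 0 := fun s m =>
    (Finset.sum_eq_zero_iff_of_nonneg fun s _ => hK s _).1 (hKcol (.inl m)) s (Finset.mem_univ _)
  have hKr : ∀ m t, K (.inr m) t = 0 := fun m t =>
    (Finset.sum_eq_zero_iff_of_nonneg fun t _ => hK _ t).1 (hKrow (.inr m)) t (Finset.mem_univ _)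
  refine ⟨fun m m' => K (.inl m) (.inr m'), fun m m' => hK _ _, fun m => ?_, fun m' => ?_, ?_⟩
  · simpa [Fintype.sum_sum_type, hKl, a] using hKrow (.inl m)
  · simpa [Fintype.sum_sum_type, hKr, b] using hKcol (.inr m')
  · rw [hre] at hcost
    simp_rw [hre, hclK] at hcost
    change ∑ s, ∑ t, K s t * |y s - y t| ≤ _ at hcost
    simp only [Fintype.sum_sum_type, hKl, hKr, zero_mul, Finset.sum_const_zero, zero_add,
      add_zero] at hcost
    refine hcost.trans ?_
    have hnM : (n : ℝ) = 2 * M - 1 := by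
      have : (M : ℝ) + M = n + 1 := by exact_mod_cast hn
      linarith
    rw [hnM]
    have hε : 0 ≤ δ ^ ((1 : ℝ) / (2 * M - 1)) := Real.rpow_nonneg hδ.le _
    nlinarith
end

section
/- There exists a universal constant C > 0 with the following property. Let M ≥ 1, n ≥ 2, let w, ŵ ∈ ℝ_{≥0}^M satisfy Σ_{m=1}^M w_m = Σ_{m=1}^M ŵ_m = 1, let ν_1,…,ν_M, ν̂_1,…,ν̂_M ∈ [0,1]^n, and let δ > 0. If ‖Σ_{m=1}^M w_m ν_m^{⊗d} − Σ_{m=1}^M ŵ_m ν̂_m^{⊗d}‖_∞ < δ for every d = 1, 2, …, 2M−1, then there exists a coupling Γ of w and ŵ with Σ_{(m,m')∈[M]²} Γ(m,m')·‖ν_m − ν̂_{m'}‖_∞ ≤ C·M³·n·δ^{1/(2M−1)}. -/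
open scoped BigOperators

/-- If the points indexed by `A` lie at distance at least `g` to the left of those indexed by `B`,
then the total mass on `A` of a signed measure is controlled by its moments. -/
theorem abs_sum_le_of_abs_moments_le {ι : Type*} [DecidableEq ι] {x : ι → ℝ}
    (hx : ∀ i, x i ∈ Set.Icc (0 : ℝ) 1) {g : ℝ} (hg : 0 < g) (hg1 : g ≤ 1) (N : ℕ) :
    ∀ (A B : Finset ι) (s : ι → ℝ) (δ : ℝ), A.card + B.card ≤ N + 1 →
      (∀ a ∈ A, ∀ b ∈ B, x a + g ≤ x b) →
      (∀ d ≤ N, |∑ i ∈ A, s i * x i ^ d + ∑ i ∈ B, s i * x i ^ d| ≤ δ) →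
      |∑ i ∈ A, s i| ≤ (4 / g) ^ N * δ := by
  have hone : 1 ≤ 4 / g := by
    rw [le_div_iff₀ hg]
    linarith
  have of_empty : ∀ (N : ℕ) (A B : Finset ι) (s : ι → ℝ) (δ : ℝ), (A = ∅ ∨ B = ∅) →
      (∀ d ≤ N, |∑ i ∈ A, s i * x i ^ d + ∑ i ∈ B, s i * x i ^ d| ≤ δ) →
      |∑ i ∈ A, s i| ≤ (4 / g) ^ N * δ := by
    intro N A B s δ hAB hm
    have h0 := hm 0 (Nat.zero_le _)
    have hδ : 0 ≤ δ := (abs_nonneg _).trans h0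
    have hle : δ ≤ (4 / g) ^ N * δ := le_mul_of_one_le_left hδ (one_le_pow₀ hone)
    rcases hAB with rfl | rfl
    · simpa using hδ.trans hle
    · simp only [pow_zero, mul_one, Finset.sum_empty, add_zero] at h0
      exact h0.trans hle
  induction N with
  | zero =>
    intro A B s δ hcard _ hm
    refine of_empty 0 A B s δ ?_ hm
    by_contra! h
    have hA := h.1.card_pos
    have hB := h.2.card_pos
    omega
  | succ N ih =>
    intro A B s δ hcard hgap hm
    rcases A.eq_empty_or_nonempty with hA | ⟨a, ha⟩
    · exact of_empty _ A B s δ (Or.inl hA) hm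
    rcases B.eq_empty_or_nonempty with hB | ⟨b, hb⟩
    · exact of_empty _ A B s δ (Or.inr hB) hm
    have shifted : ∀ c ∈ Set.Icc (0 : ℝ) 1, ∀ d ≤ N,
        |∑ i ∈ A, s i * (x i - c) * x i ^ d + ∑ i ∈ B, s i * (x i - c) * x i ^ d| ≤ 2 * δ := by
      intro c hc d hd
      have h1 := hm (d + 1) (by omega)
      have h2 := hm d (by omega)
      have hsplit : ∀ S : Finset ι, ∑ i ∈ S, s i * (x i - c) * x i ^ d =
          ∑ i ∈ S, s i * x i ^ (d + 1) - c * ∑ i ∈ S, s i * x i ^ d := by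
        intro S
        rw [Finset.mul_sum, ← Finset.sum_sub_distrib]
        exact Finset.sum_congr rfl fun i _ => by ring
      rw [hsplit, hsplit]
      rw [abs_le] at h1 h2 ⊢
      constructor <;> nlinarith [hc.1, hc.2]
    have hcA : (A.erase a).card + 1 = A.card := Finset.card_erase_add_one ha
    have hcB : (B.erase b).card + 1 = B.card := Finset.card_erase_add_one hb
    have hU := ih (A.erase a) B (fun i => s i * (x i - x a)) (2 * δ) (by omega)
      (fun i hi => hgap i (Finset.mem_of_mem_erase hi)) (by
        intro d hd
        rw [Finset.sum_erase _ (by simp)]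
        exact shifted _ (hx a) d hd)
    rw [Finset.sum_erase _ (by simp)] at hU
    have hV := ih A (B.erase b) (fun i => s i * (x i - x b)) (2 * δ) (by omega)
      (fun i hi j hj => hgap i hi j (Finset.mem_of_mem_erase hj)) (by
        intro d hd
        rw [Finset.sum_erase _ (by simp)]
        exact shifted _ (hx b) d hd)
    have hdiff : (x b - x a) * ∑ i ∈ A, s i =
        ∑ i ∈ A, s i * (x i - x a) - ∑ i ∈ A, s i * (x i - x b) := by
      rw [Finset.mul_sum, ← Finset.sum_sub_distrib]
      exact Finset.sum_congr rfl fun i _ => by ring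
    have hab := hgap a ha b hb
    have habs : g * |∑ i ∈ A, s i| ≤ (4 / g) ^ N * (4 * δ) := by
      calc g * |∑ i ∈ A, s i| ≤ (x b - x a) * |∑ i ∈ A, s i| := by
            gcongr
            linarith
        _ = |(x b - x a) * ∑ i ∈ A, s i| := by
            rw [abs_mul, abs_of_nonneg (by linarith : 0 ≤ x b - x a)]
        _ ≤ |∑ i ∈ A, s i * (x i - x a)| + |∑ i ∈ A, s i * (x i - x b)| := by
            rw [hdiff]
            exact abs_sub _ _
        _ ≤ (4 / g) ^ N * (4 * δ) := by linarith
    rw [pow_succ, mul_assoc, div_mul_eq_mul_div, mul_div_assoc', le_div_iff₀ hg]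
    linarith

/-- Two weight vectors on the line have a coupling which moves no mass across any threshold `t`
in both directions. -/
theorem exists_noncrossing_coupling {ι κ : Type*} [Fintype ι] [Fintype κ]
    {w : ι → ℝ} {w' : κ → ℝ} (hw : ∀ i, 0 ≤ w i) (hw' : ∀ j, 0 ≤ w' j)
    (hsum : ∑ i, w i = 1) (hsum' : ∑ j, w' j = 1) (x : ι → ℝ) (y : κ → ℝ) :
    ∃ Γ : ι → κ → ℝ, (∀ i j, 0 ≤ Γ i j) ∧ (∀ i, ∑ j, Γ i j = w i) ∧ (∀ j, ∑ i, Γ i j = w' j) ∧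
      ∀ t, (∀ i j, x i ≤ t → t < y j → Γ i j = 0) ∨ (∀ i j, y j ≤ t → t < x i → Γ i j = 0) := by
  classical
  let K : Set (ι → κ → ℝ) :=
    {Γ | (∀ i j, 0 ≤ Γ i j) ∧ (∀ i, ∑ j, Γ i j = w i) ∧ (∀ j, ∑ i, Γ i j = w' j)}
  have hclosed : IsClosed K := by
    have hK : K = (⋂ i, ⋂ j, {Γ | 0 ≤ Γ i j}) ∩
        ((⋂ i, {Γ | ∑ j, Γ i j = w i}) ∩ ⋂ j, {Γ | ∑ i, Γ i j = w' j}) := by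
      ext Γ
      simp [K]
    rw [hK]
    exact (isClosed_iInter fun i => isClosed_iInter fun j =>
        isClosed_le (by fun_prop) (by fun_prop)).inter
      ((isClosed_iInter fun i => isClosed_eq (by fun_prop) (by fun_prop)).inter
        (isClosed_iInter fun j => isClosed_eq (by fun_prop) (by fun_prop)))
  have hsub : K ⊆ Set.Icc (fun _ _ => 0) (fun _ _ => 1) := by
    rintro Γ ⟨h0, h1, -⟩
    refine ⟨fun i j => h0 i j, fun i j => ?_⟩
    calc Γ i j ≤ ∑ j, Γ i j := Finset.single_le_sum (fun j _ => h0 i j) (Finset.mem_univ j)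
      _ = w i := h1 i
      _ ≤ ∑ i, w i := Finset.single_le_sum (fun i _ => hw i) (Finset.mem_univ i)
      _ = 1 := hsum
  have hcompact : IsCompact K := isCompact_Icc.of_isClosed_subset hclosed hsub
  have hne : K.Nonempty :=
    ⟨fun i j => w i * w' j, fun i j => mul_nonneg (hw i) (hw' j),
      fun i => by rw [← Finset.mul_sum, hsum', mul_one],
      fun j => by rw [← Finset.sum_mul, hsum, one_mul]⟩
  obtain ⟨Γ, ⟨h0, h1, h2⟩, hmin⟩ := hcompact.exists_isMinOn hne
    (f := fun Γ => ∑ i, ∑ j, Γ i j * |x i - y j|) (by fun_prop)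
  refine ⟨Γ, h0, h1, h2, fun t => ?_⟩
  by_contra! hcross
  obtain ⟨⟨i, j, hi, hj, hij⟩, ⟨k, l, hl, hk, hkl⟩⟩ := hcross
  have hik : i ≠ k := by
    rintro rfl
    linarith
  have hjl : j ≠ l := by
    rintro rfl
    linarith
  set ε := min (Γ i j) (Γ k l)
  have hεpos : 0 < ε := lt_min ((h0 i j).lt_of_ne' hij) ((h0 k l).lt_of_ne' hkl)
  let u : ι → ℝ := Pi.single i 1 - Pi.single k 1
  let v : κ → ℝ := Pi.single l 1 - Pi.single j 1
  have hu : ∀ f : ι → ℝ, ∑ a, u a * f a = f i - f k := by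
    intro f
    simp [u, sub_mul, Finset.sum_sub_distrib, Pi.single_apply]
  have hv : ∀ f : κ → ℝ, ∑ b, v b * f b = f l - f j := by
    intro f
    simp [v, sub_mul, Finset.sum_sub_distrib, Pi.single_apply]
  have hmem : (fun a b => Γ a b + ε * (u a * v b)) ∈ K := by
    refine ⟨fun a b => ?_, fun a => ?_, fun b => ?_⟩
    · have hεij : ε ≤ Γ i j := min_le_left _ _
      have hεkl : ε ≤ Γ k l := min_le_right _ _
      have hab := h0 a b
      simp only [u, v, Pi.sub_apply, Pi.single_apply]
      split_ifs <;> subst_vars <;> first | contradiction | linarith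
    · rw [Finset.sum_add_distrib, h1, ← Finset.mul_sum, ← Finset.mul_sum]
      have := hv fun _ => 1
      simp only [mul_one, sub_self] at this
      rw [this]
      ring
    · rw [Finset.sum_add_distrib, h2, ← Finset.mul_sum, ← Finset.sum_mul]
      have := hu fun _ => 1
      simp only [mul_one, sub_self] at this
      rw [this]
      ring
  have hle := hmin hmem
  have hcost : ∑ a, ∑ b, (Γ a b + ε * (u a * v b)) * |x a - y b| =
      ∑ a, ∑ b, Γ a b * |x a - y b| +
        ε * ((|x i - y l| - |x i - y j|) - (|x k - y l| - |x k - y j|)) := by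
    rw [← hv fun b => |x i - y b|, ← hv fun b => |x k - y b|,
      ← hu fun a => ∑ b, v b * |x a - y b|]
    simp only [Finset.mul_sum, ← Finset.sum_add_distrib]
    exact Finset.sum_congr rfl fun a _ => Finset.sum_congr rfl fun b _ => by ring
  simp only [Set.mem_ofPred_eq, hcost] at hle
  have hlt : (|x i - y l| - |x i - y j|) - (|x k - y l| - |x k - y j|) < 0 := by
    rw [abs_of_neg (by linarith : x i - y j < 0), abs_of_pos (by linarith : 0 < x k - y l)]
    rcases abs_cases (x i - y l) with h | h <;> rcases abs_cases (x k - y j) with h' | h' <;>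
      linarith
  linarith [mul_neg_of_pos_of_neg hεpos hlt]

/-- The real values of a function on a type with `N + 1` elements, listed in increasing order. -/
theorem exists_monotone_enumeration {α : Type*} [Fintype α] {N : ℕ}
    (hcard : Fintype.card α = N + 1) (f : α → ℝ) :
    ∃ z : ℕ → ℝ, Monotone z ∧ (∀ a, ∃ r ≤ N, f a = z r) ∧ ∀ r, ∃ a, z r = f a := by
  let e : α ≃ Fin (N + 1) := Fintype.equivFinOfCardEq hcard
  let h : Fin (N + 1) → ℝ := f ∘ e.symm
  refine ⟨fun r => h (Tuple.sort h ⟨min r N, by omega⟩), ?_, fun a => ?_, fun r => ⟨_, rfl⟩⟩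
  · intro r r' hr
    exact Tuple.monotone_sort h (by simp only [Fin.mk_le_mk]; omega)
  · refine ⟨(Tuple.sort h).symm (e a), by omega, ?_⟩
    have hmin : min (((Tuple.sort h).symm (e a) : Fin (N + 1)) : ℕ) N =
        ((Tuple.sort h).symm (e a) : Fin (N + 1)) := by omega
    simp [hmin, h]

/-- The distance between two points of a monotone sequence is at most the sum of the gaps
separating them. -/
theorem abs_sub_le_sum_gaps {z : ℕ → ℝ} (hz : Monotone z) {N p q : ℕ} (hp : p ≤ N) (hq : q ≤ N) :
    |z p - z q| ≤ ∑ r ∈ Finset.range N, (z (r + 1) - z r) *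
      |(if z p ≤ z r then 1 else 0) - (if z q ≤ z r then (1 : ℝ) else 0)| := by
  wlog hpq : p ≤ q generalizing p q
  · have := this hq hp (by omega)
    rw [abs_sub_comm]
    refine this.trans_eq (Finset.sum_congr rfl fun r _ => ?_)
    rw [abs_sub_comm]
  have hgap : ∀ r, 0 ≤ z (r + 1) - z r := fun r => sub_nonneg.2 (hz (Nat.le_succ r))
  rw [abs_sub_comm, abs_of_nonneg (sub_nonneg.2 (hz hpq)), ← Finset.sum_Ico_sub z hpq]
  refine le_trans (Finset.sum_le_sum (fun r hr => ?_)) (Finset.sum_le_sum_of_subset_of_nonneg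
    (fun r hr => ?_) fun r _ _ => mul_nonneg (hgap r) (abs_nonneg _))
  · rw [Finset.mem_Ico] at hr
    rw [if_pos (hz hr.1)]
    split_ifs with h
    · have := hz (show r + 1 ≤ q by omega)
      simp only [sub_self, abs_zero, mul_zero]
      linarith
    · simp
  · rw [Finset.mem_Ico] at hr
    rw [Finset.mem_range]
    omega

/-- A coupling that crosses the threshold `t` in one direction only moves across it exactly the
difference of the masses to the left of `t`. -/
theorem sum_crossing_eq_abs_sub {ι κ : Type*} [Fintype ι] [Fintype κ]
    {w : ι → ℝ} {w' : κ → ℝ} {x : ι → ℝ} {y : κ → ℝ} {Γ : ι → κ → ℝ} (h0 : ∀ i j, 0 ≤ Γ i j)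
    (h1 : ∀ i, ∑ j, Γ i j = w i) (h2 : ∀ j, ∑ i, Γ i j = w' j) {t : ℝ}
    (ht : (∀ i j, x i ≤ t → t < y j → Γ i j = 0) ∨ (∀ i j, y j ≤ t → t < x i → Γ i j = 0)) :
    ∑ i, ∑ j, Γ i j * |(if x i ≤ t then 1 else 0) - (if y j ≤ t then (1 : ℝ) else 0)| =
      |∑ i, w i * (if x i ≤ t then 1 else 0) - ∑ j, w' j * (if y j ≤ t then 1 else 0)| := by
  have hdiff : ∑ i, w i * (if x i ≤ t then 1 else 0) - ∑ j, w' j * (if y j ≤ t then 1 else 0) =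
      ∑ i, ∑ j, Γ i j * ((if x i ≤ t then 1 else 0) - (if y j ≤ t then (1 : ℝ) else 0)) := by
    simp only [← h1, ← h2, mul_sub, Finset.sum_sub_distrib, Finset.sum_mul]
    congr 1
    rw [Finset.sum_comm]
  rcases ht with ht | ht
  · rw [← abs_neg, hdiff, ← Finset.sum_neg_distrib]
    simp only [← Finset.sum_neg_distrib]
    have hterm : ∀ i j,
        Γ i j * |(if x i ≤ t then 1 else 0) - (if y j ≤ t then (1 : ℝ) else 0)| =
          -(Γ i j * ((if x i ≤ t then 1 else 0) - (if y j ≤ t then (1 : ℝ) else 0))) := by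
      intro i j
      split_ifs with hx hy hy
      · simp
      · simp [ht i j hx (not_le.1 hy)]
      · simp
      · simp
    rw [← Finset.sum_congr rfl fun i _ => Finset.sum_congr rfl fun j _ => hterm i j,
      abs_of_nonneg]
    exact Finset.sum_nonneg fun i _ => Finset.sum_nonneg fun j _ =>
      mul_nonneg (h0 i j) (abs_nonneg _)
  · rw [hdiff]
    have hterm : ∀ i j,
        Γ i j * |(if x i ≤ t then 1 else 0) - (if y j ≤ t then (1 : ℝ) else 0)| =
          Γ i j * ((if x i ≤ t then 1 else 0) - (if y j ≤ t then (1 : ℝ) else 0)) := by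
      intro i j
      split_ifs with hx hy hy
      · simp
      · simp
      · simp [ht i j hy (not_le.1 hx)]
      · simp
    rw [← Finset.sum_congr rfl fun i _ => Finset.sum_congr rfl fun j _ => hterm i j,
      abs_of_nonneg]
    exact Finset.sum_nonneg fun i _ => Finset.sum_nonneg fun j _ =>
      mul_nonneg (h0 i j) (abs_nonneg _)

/-- The mass a weight vector puts to the left of a threshold lies between `0` and `1`. -/
theorem sum_mul_ite_mem_Icc {ι : Type*} [Fintype ι] {w : ι → ℝ} (hw : ∀ i, 0 ≤ w i)
    (hsum : ∑ i, w i = 1) (x : ι → ℝ) (t : ℝ) :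
    ∑ i, w i * (if x i ≤ t then 1 else 0) ∈ Set.Icc (0 : ℝ) 1 := by
  refine ⟨Finset.sum_nonneg fun i _ => mul_nonneg (hw i) (by split_ifs <;> norm_num), ?_⟩
  refine le_of_le_of_eq (Finset.sum_le_sum fun i _ => ?_) hsum
  exact mul_le_of_le_one_right (hw i) (by split_ifs <;> norm_num)

/-- Two discrete probability measures on `[0, 1]` with `N + 1` atoms altogether whose first `N`
moments are `δ`-close have a coupling of cost at most `4 N δ ^ (1 / N)`. -/
theorem exists_coupling_of_moments_close {ι κ : Type*} [Fintype ι] [Fintype κ] {N : ℕ}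
    (hN : N ≠ 0) (hcard : Fintype.card ι + Fintype.card κ = N + 1)
    {w : ι → ℝ} {w' : κ → ℝ} (hw : ∀ i, 0 ≤ w i) (hw' : ∀ j, 0 ≤ w' j)
    (hsum : ∑ i, w i = 1) (hsum' : ∑ j, w' j = 1) {x : ι → ℝ} {y : κ → ℝ}
    (hx : ∀ i, x i ∈ Set.Icc (0 : ℝ) 1) (hy : ∀ j, y j ∈ Set.Icc (0 : ℝ) 1) {δ : ℝ} (hδ : 0 ≤ δ)
    (hm : ∀ d, 1 ≤ d → d ≤ N → |∑ i, w i * x i ^ d - ∑ j, w' j * y j ^ d| ≤ δ) :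
    ∃ Γ : ι → κ → ℝ, (∀ i j, 0 ≤ Γ i j) ∧ (∀ i, ∑ j, Γ i j = w i) ∧ (∀ j, ∑ i, Γ i j = w' j) ∧
      ∑ i, ∑ j, Γ i j * |x i - y j| ≤ N * (4 * δ ^ ((1 : ℝ) / N)) := by
  classical
  obtain ⟨Γ, h0, h1, h2, hcross⟩ := exists_noncrossing_coupling hw hw' hsum hsum' x y
  refine ⟨Γ, h0, h1, h2, ?_⟩
  obtain ⟨z, hz, hfz, hzf⟩ := exists_monotone_enumeration (N := N)
    (by rw [Fintype.card_sum, hcard]) (Sum.elim x y)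
  have hxy : ∀ a, Sum.elim x y a ∈ Set.Icc (0 : ℝ) 1 := by
    rintro (i | j)
    exacts [hx i, hy j]
  have hz01 : ∀ r, z r ∈ Set.Icc (0 : ℝ) 1 := by
    intro r
    obtain ⟨a, ha⟩ := hzf r
    exact ha ▸ hxy a
  let D : ℕ → ℝ := fun r =>
    |∑ i, w i * (if x i ≤ z r then 1 else 0) - ∑ j, w' j * (if y j ≤ z r then 1 else 0)|
  have hcost : ∑ i, ∑ j, Γ i j * |x i - y j| ≤
      ∑ r ∈ Finset.range N, (z (r + 1) - z r) * D r := by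
    calc ∑ i, ∑ j, Γ i j * |x i - y j|
        ≤ ∑ i, ∑ j, Γ i j * ∑ r ∈ Finset.range N, (z (r + 1) - z r) *
          |(if x i ≤ z r then 1 else 0) - (if y j ≤ z r then (1 : ℝ) else 0)| := by
          gcongr with i _ j _
          · exact h0 i j
          · obtain ⟨p, hp, hxp⟩ := hfz (Sum.inl i)
            obtain ⟨q, hq, hyq⟩ := hfz (Sum.inr j)
            rw [Sum.elim_inl] at hxp
            rw [Sum.elim_inr] at hyq
            rw [hxp, hyq]
            exact abs_sub_le_sum_gaps hz hp hq
      _ = ∑ r ∈ Finset.range N, (z (r + 1) - z r) * ∑ i, ∑ j, Γ i j *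
          |(if x i ≤ z r then 1 else 0) - (if y j ≤ z r then (1 : ℝ) else 0)| := by
          simp only [Finset.mul_sum]
          rw [Finset.sum_comm_cycle]
          refine Finset.sum_congr rfl fun r _ => ?_
          exact Finset.sum_congr rfl fun i _ => Finset.sum_congr rfl fun j _ => by ring
      _ = _ := Finset.sum_congr rfl fun r _ => by
          rw [sum_crossing_eq_abs_sub h0 h1 h2 (hcross (z r))]
  refine hcost.trans ?_
  refine (Finset.sum_le_card_nsmul _ _ (4 * δ ^ ((1 : ℝ) / N)) fun r hr => ?_).trans_eq
    (by rw [Finset.card_range, nsmul_eq_mul])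
  have hD1 : D r ≤ 1 := by
    have hl := sum_mul_ite_mem_Icc hw hsum x (z r)
    have hr := sum_mul_ite_mem_Icc hw' hsum' y (z r)
    exact abs_le.2 ⟨by linarith [hl.1, hr.2], by linarith [hl.2, hr.1]⟩
  have hDm : 0 < z (r + 1) - z r → D r ≤ (4 / (z (r + 1) - z r)) ^ N * δ := by
    intro hg
    let f := Sum.elim x y
    let s : ι ⊕ κ → ℝ := Sum.elim w fun j => -w' j
    have hmoment := abs_sum_le_of_abs_moments_le hxy hg
      (by linarith [(hz01 (r + 1)).2, (hz01 r).1]) N (Finset.univ.filter fun a => f a ≤ z r)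
      (Finset.univ.filter fun a => ¬ f a ≤ z r) s δ
      (by rw [Finset.card_filter_add_card_filter_not, Finset.card_univ, Fintype.card_sum, hcard])
      (by
        intro a ha b hb
        simp only [Finset.mem_filter, Finset.mem_univ, true_and, not_le, f] at ha hb
        obtain ⟨q, -, hq⟩ := hfz b
        rw [hq] at hb ⊢
        have hrq : r + 1 ≤ q := hz.reflect_lt hb
        linarith [hz hrq])
      (by
        intro d hd
        rw [Finset.sum_filter_add_sum_filter_not, Fintype.sum_sum_type]
        simp only [s, Sum.elim_inl, Sum.elim_inr, neg_mul, Finset.sum_neg_distrib,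
          ← sub_eq_add_neg]
        rcases Nat.eq_zero_or_pos d with rfl | hd0
        · simpa [hsum, hsum'] using hδ
        · exact hm d hd0 hd)
    refine le_of_eq_of_le ?_ hmoment
    rw [Finset.sum_filter, Fintype.sum_sum_type]
    simp only [D, s, f, Sum.elim_inl, Sum.elim_inr, mul_ite, mul_one, mul_zero, sub_eq_add_neg,
      ← Finset.sum_neg_distrib]
    congr 2
    refine Finset.sum_congr rfl fun j _ => ?_
    by_cases h : y j ≤ z r
    · rw [if_pos h]
      exact (if_pos h).symm
    · rw [if_neg h, neg_zero]
      exact (if_neg h).symm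
  have hg0 : 0 ≤ z (r + 1) - z r := sub_nonneg.2 (hz (Nat.le_succ r))
  have hη : 0 ≤ δ ^ ((1 : ℝ) / N) := Real.rpow_nonneg hδ _
  rcases hg0.eq_or_lt with hg | hg
  · rw [← hg, zero_mul]
    positivity
  have hD0 : 0 ≤ D r := abs_nonneg _
  refine le_of_pow_le_pow_left₀ hN (by positivity) ?_
  have hroot : (δ ^ ((1 : ℝ) / N)) ^ N = δ := by
    rw [one_div, Real.rpow_inv_natCast_pow hδ hN]
  calc ((z (r + 1) - z r) * D r) ^ N = (z (r + 1) - z r) ^ N * D r ^ N := mul_pow _ _ _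
    _ ≤ (z (r + 1) - z r) ^ N * D r := by
        gcongr
        exact pow_le_of_le_one hD0 hD1 hN
    _ ≤ (z (r + 1) - z r) ^ N * ((4 / (z (r + 1) - z r)) ^ N * δ) := by
        gcongr
        exact hDm hg
    _ = (4 * δ ^ ((1 : ℝ) / N)) ^ N := by
        rw [mul_pow 4, hroot, ← mul_assoc, ← mul_pow, mul_div_cancel₀ _ hg.ne']

/-- Some direction `θ` separates finitely many vectors from `0` in terms of their largest
coordinate. -/
theorem exists_direction {ι P : Type*} [Fintype ι] [Nonempty ι] [Fintype P] (v : P → ι → ℝ) :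
    ∃ θ : ι → ℝ, (∀ i, 0 ≤ θ i) ∧ ∑ i, θ i ≤ 1 ∧ ∀ p i,
      |v p i| ≤ 2 * Fintype.card ι * (Fintype.card P + 1) * |∑ i, θ i * v p i| := by
  classical
  set K := Fintype.card P + 1 with hK
  choose top htop using fun p => Finite.exists_max fun i => |v p i|
  let bad : P → Finset (ι → Fin K) := fun p =>
    Finset.univ.filter fun k => |∑ i, (k i : ℝ) * v p i| < |v p (top p)| / 2
  have hbad : ∀ p, (bad p).card * K ≤ Fintype.card (ι → Fin K) := by
    intro p
    have hprod : (bad p).card * K = (bad p ×ˢ (Finset.univ : Finset (Fin K))).card := by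
      rw [Finset.card_product, Finset.card_univ, Fintype.card_fin]
    rw [hprod, ← Finset.card_univ]
    refine Finset.card_le_card_of_injOn (fun kc => Function.update kc.1 (top p) kc.2)
      (fun _ _ => Finset.mem_coe.2 (Finset.mem_univ _)) ?_
    rintro ⟨k, c⟩ hk ⟨k', c'⟩ hk' heq
    simp only [Finset.coe_product, Set.mem_prod, Finset.mem_coe, bad, Finset.mem_filter,
      Finset.mem_univ, true_and, and_true] at hk hk'
    have hc : c = c' := by simpa using congrFun heq (top p)
    have hoff : ∀ i, i ≠ top p → k i = k' i := fun i hi => by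
      simpa [Function.update_of_ne hi] using congrFun heq i
    have hdiff : ∑ i, (k i : ℝ) * v p i - ∑ i, (k' i : ℝ) * v p i =
        ((k (top p) : ℝ) - k' (top p)) * v p (top p) := by
      rw [← Finset.sum_sub_distrib, Finset.sum_eq_single (top p)]
      · ring
      · intro i _ hi
        rw [hoff i hi, sub_self]
      · simp
    have hlt : |((k (top p) : ℝ) - k' (top p))| * |v p (top p)| < 1 * |v p (top p)| := by
      rw [← abs_mul, ← hdiff]
      linarith [abs_sub (∑ i, (k i : ℝ) * v p i) (∑ i, (k' i : ℝ) * v p i)]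
    have hlt1 := lt_of_mul_lt_mul_right hlt (abs_nonneg _)
    have htopeq : k (top p) = k' (top p) := by
      have hint : |((k (top p) : ℕ) : ℤ) - ((k' (top p) : ℕ) : ℤ)| < 1 := by exact_mod_cast hlt1
      rw [Int.abs_lt_one_iff] at hint
      omega
    have hkk : k = k' := by
      funext i
      by_cases hi : i = top p
      · rw [hi, htopeq]
      · exact hoff i hi
    rw [hkk, hc]
  obtain ⟨k, hk⟩ : ∃ k : ι → Fin K, ∀ p, k ∉ bad p := by
    by_contra! hall
    have hcover : Fintype.card (ι → Fin K) ≤ ∑ p, (bad p).card := by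
      rw [← Finset.card_univ]
      refine (Finset.card_le_card fun k _ => ?_).trans Finset.card_biUnion_le
      simpa using hall k
    have hpos : 0 < Fintype.card (ι → Fin K) := Fintype.card_pos
    have : (∑ p, (bad p).card) * K ≤ Fintype.card P * Fintype.card (ι → Fin K) := by
      rw [Finset.sum_mul, ← smul_eq_mul, ← Finset.card_univ]
      exact Finset.sum_le_card_nsmul _ _ _ fun p _ => hbad p
    nlinarith
  have hn : (0 : ℝ) < Fintype.card ι := by exact_mod_cast Fintype.card_pos
  have hKpos : (0 : ℝ) < K := by positivity
  refine ⟨fun i => k i / (Fintype.card ι * K), fun i => by positivity, ?_, fun p i => ?_⟩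
  · rw [← Finset.sum_div, div_le_one (by positivity)]
    calc ∑ i, ((k i : ℕ) : ℝ) ≤ Finset.univ.card • (K : ℝ) :=
          Finset.sum_le_card_nsmul _ _ _ fun i _ => by exact_mod_cast (k i).isLt.le
      _ = Fintype.card ι * K := by rw [nsmul_eq_mul, Finset.card_univ]
  · have hkp := hk p
    simp only [bad, Finset.mem_filter, Finset.mem_univ, true_and, not_lt] at hkp
    have hfactor : ∑ i, (k i : ℝ) / (Fintype.card ι * K) * v p i =
        (∑ i, (k i : ℝ) * v p i) / (Fintype.card ι * K) := by
      rw [Finset.sum_div]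
      exact Finset.sum_congr rfl fun i _ => by ring
    have hKc : (Fintype.card P : ℝ) + 1 = K := by rw [hK]; push_cast; rfl
    rw [hfactor, abs_div, abs_of_pos (by positivity : (0 : ℝ) < Fintype.card ι * K), hKc]
    calc |v p i| ≤ |v p (top p)| := htop p i
      _ ≤ 2 * |∑ i, (k i : ℝ) * v p i| := by linarith
      _ = _ := by field_simp

/-- The moments of a projection of a discrete measure in terms of its moment tensor. -/
theorem sum_mul_pow_sum_eq {ι σ : Type*} [Fintype ι] [Fintype σ] (w : ι → ℝ) (ν : ι → σ → ℝ)
    (θ : σ → ℝ) (d : ℕ) :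
    ∑ m, w m * (∑ i, θ i * ν m i) ^ d =
      ∑ idx : Fin d → σ, (∏ j, θ (idx j)) * ∑ m, w m * ∏ j, ν m (idx j) := by
  simp only [Fintype.sum_pow, Finset.prod_mul_distrib, Finset.mul_sum]
  rw [Finset.sum_comm]
  exact Finset.sum_congr rfl fun _ _ => Finset.sum_congr rfl fun _ _ => by ring

/-- Closeness of the moment tensors passes to the moments of projections along directions in the
unit simplex. -/
theorem abs_projected_moments_le {ι κ σ : Type*} [Fintype ι] [Fintype κ] [Fintype σ]
    {w : ι → ℝ} {w' : κ → ℝ} {ν : ι → σ → ℝ} {ν' : κ → σ → ℝ} {θ : σ → ℝ}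
    (hθ : ∀ i, 0 ≤ θ i) (hθ1 : ∑ i, θ i ≤ 1) {δ : ℝ} (hδ : 0 ≤ δ) {d : ℕ}
    (hm : ∀ idx : Fin d → σ,
      |∑ m, w m * ∏ j, ν m (idx j) - ∑ m, w' m * ∏ j, ν' m (idx j)| ≤ δ) :
    |∑ m, w m * (∑ i, θ i * ν m i) ^ d - ∑ m, w' m * (∑ i, θ i * ν' m i) ^ d| ≤ δ := by
  rw [sum_mul_pow_sum_eq, sum_mul_pow_sum_eq, ← Finset.sum_sub_distrib]
  simp only [← mul_sub]
  have hprod : ∀ idx : Fin d → σ, 0 ≤ ∏ j, θ (idx j) := fun idx =>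
    Finset.prod_nonneg fun j _ => hθ _
  calc _ ≤ ∑ idx : Fin d → σ, |(∏ j, θ (idx j)) *
        (∑ m, w m * ∏ j, ν m (idx j) - ∑ m, w' m * ∏ j, ν' m (idx j))| :=
        Finset.abs_sum_le_sum_abs _ _
    _ ≤ ∑ idx : Fin d → σ, (∏ j, θ (idx j)) * δ := by
        refine Finset.sum_le_sum fun idx _ => ?_
        rw [abs_mul, abs_of_nonneg (hprod idx)]
        exact mul_le_mul_of_nonneg_left (hm idx) (hprod idx)
    _ = (∑ i, θ i) ^ d * δ := by rw [← Finset.sum_mul, Fintype.sum_pow]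
    _ ≤ δ := mul_le_of_le_one_left hδ (pow_le_one₀ (Finset.sum_nonneg fun i _ => hθ i) hθ1)

theorem stmt5 :
    ∃ C : ℝ, 0 < C ∧
      ∀ (M n : ℕ), 1 ≤ M → ∀ (hn : 2 ≤ n),
      ∀ (w wh : Fin M → ℝ), (∀ m, 0 ≤ w m) → (∀ m, 0 ≤ wh m) →
        (∑ m, w m = 1) → (∑ m, wh m = 1) →
      ∀ (ν νh : Fin M → Fin n → ℝ),
        (∀ m i, ν m i ∈ Set.Icc (0 : ℝ) 1) →
        (∀ m i, νh m i ∈ Set.Icc (0 : ℝ) 1) →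
      ∀ δ : ℝ, 0 < δ →
        (∀ d : ℕ, 1 ≤ d → d ≤ 2 * M - 1 → ∀ idx : Fin d → Fin n,
          |∑ m, w m * ∏ j, ν m (idx j) - ∑ m, wh m * ∏ j, νh m (idx j)| < δ) →
        ∃ Γ : Fin M → Fin M → ℝ,
          (∀ m m', 0 ≤ Γ m m') ∧
          (∀ m, ∑ m', Γ m m' = w m) ∧
          (∀ m', ∑ m, Γ m m' = wh m') ∧
          ∑ m, ∑ m', Γ m m' *
              (Finset.univ.sup' (Finset.univ_nonempty_iff.mpr ⟨⟨0, by omega⟩⟩)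
                fun i : Fin n => |ν m i - νh m' i|) ≤
            C * M ^ 3 * n * δ ^ ((1 : ℝ) / (2 * M - 1)) := by
  refine ⟨32, by norm_num, ?_⟩
  intro M n hM hn w wh hw hwh hsum hsumh ν νh hν hνh δ hδ hm
  have : NeZero n := ⟨by omega⟩
  obtain ⟨θ, hθ, hθ1, hsep⟩ :=
    exists_direction fun (p : Fin M × Fin M) (i : Fin n) => ν p.1 i - νh p.2 i
  have hproj : ∀ f : Fin n → ℝ, (∀ i, f i ∈ Set.Icc (0 : ℝ) 1) →
      ∑ i, θ i * f i ∈ Set.Icc (0 : ℝ) 1 := fun f hf =>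
    ⟨Finset.sum_nonneg fun i _ => mul_nonneg (hθ i) (hf i).1,
      (Finset.sum_le_sum fun i _ => mul_le_of_le_one_right (hθ i) (hf i).2).trans hθ1⟩
  obtain ⟨Γ, h0, h1, h2, hcost⟩ := exists_coupling_of_moments_close (N := 2 * M - 1) (by omega)
    (by simp only [Fintype.card_fin]; omega) hw hwh hsum hsumh
    (fun m => hproj (ν m) (hν m)) (fun m => hproj (νh m) (hνh m)) hδ.le
    (fun d hd hdN => abs_projected_moments_le hθ hθ1 hδ.le fun idx => (hm d hd hdN idx).le)
  refine ⟨Γ, h0, h1, h2, ?_⟩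
  have hNcast : ((2 * M - 1 : ℕ) : ℝ) = 2 * M - 1 := by
    rw [Nat.cast_sub (by omega)]
    push_cast
    ring
  rw [hNcast] at hcost
  have hM1 : (1 : ℝ) ≤ M := by exact_mod_cast hM
  set η := δ ^ ((1 : ℝ) / (2 * M - 1))
  have hη0 : 0 ≤ η := Real.rpow_nonneg hδ.le _
  calc _ ≤ ∑ m, ∑ m', Γ m m' * (2 * n * (M * M + 1) *
        |∑ i, θ i * ν m i - ∑ i, θ i * νh m' i|) := by
        gcongr with m _ m' _
        · exact h0 m m'
        · refine Finset.sup'_le _ _ fun i _ => ?_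
          have := hsep (m, m') i
          simpa [mul_sub, Finset.sum_sub_distrib] using this
    _ = 2 * n * (M * M + 1) *
        ∑ m, ∑ m', Γ m m' * |∑ i, θ i * ν m i - ∑ i, θ i * νh m' i| := by
        simp only [Finset.mul_sum]
        exact Finset.sum_congr rfl fun _ _ => Finset.sum_congr rfl fun _ _ => by ring
    _ ≤ (2 * n * (2 * M ^ 2)) * (2 * M * (4 * η)) := by
        refine mul_le_mul ?_ (hcost.trans ?_) ?_ (by positivity)
        · gcongr
          nlinarith
        · gcongr
          linarith
        · exact Finset.sum_nonneg fun m _ => Finset.sum_nonneg fun m' _ =>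
            mul_nonneg (h0 m m') (abs_nonneg _)
    _ = 32 * M ^ 3 * n * η := by ring
end

section
/- Let n ≥ 1, M ≥ 1, and let X ⊆ ℝ^n ∖ {0} be a finite set with |X| ≤ M². Then there exists a vector θ ∈ ℝ^n with ‖θ‖_1 = 1 such that ‖x‖_∞ ≤ 4M²n·|⟨θ, x⟩| for every x ∈ X. -/
open scoped BigOperators

/-- Among the integer vectors with coordinates in `{0, …, N - 1}`, those for which `⟨t, x⟩` is
less than half of `|x i|` in absolute value are determined by their coordinates other than `i`. -/
theorem card_filter_abs_sum_mul_lt_le {n N : ℕ} (x : Fin n → ℝ) (i : Fin n) :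
    (Finset.univ.filter fun t : Fin n → Fin N =>
      |∑ j, ((t j : ℕ) : ℝ) * x j| < |x i| / 2).card ≤ N ^ (n - 1) := by
  classical
  have hcard : Fintype.card ({j : Fin n // j ≠ i} → Fin N) = N ^ (n - 1) := by
    simp [Fintype.card_subtype_compl]
  rw [← hcard, ← Finset.card_univ]
  refine Finset.card_le_card_of_injOn (fun t j => t j.1) (fun _ _ => Finset.mem_coe.2
    (Finset.mem_univ _)) ?_
  intro s hs t ht hst
  simp only [Finset.coe_filter, Finset.mem_univ, true_and, Set.mem_ofPred_eq] at hs ht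
  have hne : ∀ j, j ≠ i → s j = t j := fun j hj => congrFun hst ⟨j, hj⟩
  have hdiff : ∑ j, ((s j : ℕ) : ℝ) * x j - ∑ j, ((t j : ℕ) : ℝ) * x j
      = (((s i : ℕ) : ℝ) - ((t i : ℕ) : ℝ)) * x i := by
    rw [← Finset.sum_sub_distrib, Finset.sum_eq_single i]
    · ring
    · intro j _ hj
      rw [hne j hj, sub_self]
    · simp
  have hlt : |(((s i : ℕ) : ℝ) - ((t i : ℕ) : ℝ))| * |x i| < |x i| := by
    rw [← abs_mul, ← hdiff]
    exact (abs_sub _ _).trans_lt (by linarith)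
  have hi : s i = t i := by
    by_contra h
    have hz : ((s i : ℕ) : ℤ) - ((t i : ℕ) : ℤ) ≠ 0 := by
      intro h'
      exact h (Fin.ext (by omega))
    have h1 : (1 : ℝ) ≤ |(((s i : ℕ) : ℝ) - ((t i : ℕ) : ℝ))| := by
      exact_mod_cast Int.one_le_abs hz
    nlinarith [abs_nonneg (x i)]
  funext j
  by_cases hj : j = i
  · rw [hj, hi]
  · exact hne j hj

/-- Fewer than `N` vectors admit a common integer vector with coordinates in `{0, …, N - 1}` whose
pairing with each of them is at least half of the sup norm. -/
theorem exists_forall_abs_div_two_le_abs_sum_mul {n N : ℕ} (hn : 1 ≤ n)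
    (X : Finset (Fin n → ℝ)) (hX : X.card < N) :
    ∃ t : Fin n → Fin N, ∀ x ∈ X, ∀ i, |x i| / 2 ≤ |∑ j, ((t j : ℕ) : ℝ) * x j| := by
  classical
  have : Nonempty (Fin n) := ⟨⟨0, hn⟩⟩
  choose m hm using fun x : Fin n → ℝ => Finite.exists_max fun i => |x i|
  let B : (Fin n → ℝ) → Finset (Fin n → Fin N) := fun x => Finset.univ.filter fun t =>
    |∑ j, ((t j : ℕ) : ℝ) * x j| < |x (m x)| / 2
  have hlt : (X.biUnion B).card < (Finset.univ : Finset (Fin n → Fin N)).card := by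
    calc (X.biUnion B).card ≤ X.card * N ^ (n - 1) :=
          Finset.card_biUnion_le_card_mul _ _ _ fun x _ => card_filter_abs_sum_mul_lt_le x (m x)
      _ < N * N ^ (n - 1) := Nat.mul_lt_mul_of_pos_right hX (pow_pos (by omega) _)
      _ = (Finset.univ : Finset (Fin n → Fin N)).card := by
          rw [← pow_succ', Nat.sub_add_cancel hn]
          simp
  obtain ⟨t, -, ht⟩ := Finset.exists_mem_notMem_of_card_lt_card hlt
  refine ⟨t, fun x hx i => ?_⟩
  have h : |x (m x)| / 2 ≤ |∑ j, ((t j : ℕ) : ℝ) * x j| := by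
    by_contra! h
    exact ht (Finset.mem_biUnion.2 ⟨x, hx, Finset.mem_filter.2 ⟨Finset.mem_univ _, h⟩⟩)
  linarith [hm x i]

theorem stmt7 (n M : ℕ) (hn : 1 ≤ n) (hM : 1 ≤ M)
    (X : Finset (Fin n → ℝ)) (hX0 : ∀ x ∈ X, x ≠ 0)
    (hXcard : X.card ≤ M ^ 2) :
    ∃ θ : Fin n → ℝ, (∑ i, |θ i| = 1) ∧
      ∀ x ∈ X, ∀ i : Fin n,
        |x i| ≤ 4 * M ^ 2 * n * |∑ j, θ j * x j| := by
  obtain rfl | ⟨y, hy⟩ := X.eq_empty_or_nonempty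
  · refine ⟨Pi.single ⟨0, hn⟩ 1, ?_, by simp⟩
    rw [Finset.sum_eq_single ⟨0, hn⟩] <;> simp +contextual
  obtain ⟨t, ht⟩ := exists_forall_abs_div_two_le_abs_sum_mul hn X (Nat.lt_succ_of_le hXcard)
  set S : ℝ := ∑ i, ((t i : ℕ) : ℝ) with hS
  have hS0 : 0 < S := by
    refine lt_of_le_of_ne (Finset.sum_nonneg fun i _ => Nat.cast_nonneg _) fun h => ?_
    have h0 := (Finset.sum_eq_zero_iff_of_nonneg fun i _ => Nat.cast_nonneg _).1 h.symm
    refine hX0 y hy (funext fun i => ?_)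
    have h1 := ht y hy i
    rw [Finset.sum_eq_zero fun j hj => by rw [h0 j hj, zero_mul], abs_zero] at h1
    exact abs_eq_zero.1 (le_antisymm (by linarith) (abs_nonneg _))
  have hSle : S ≤ n * (M : ℝ) ^ 2 := by
    have h : S ≤ ∑ _i : Fin n, (M : ℝ) ^ 2 :=
      Finset.sum_le_sum fun i _ => by exact_mod_cast Nat.lt_succ_iff.1 (t i).2
    simpa using h
  refine ⟨fun i => ((t i : ℕ) : ℝ) / S, ?_, fun x hx i => ?_⟩
  · simp_rw [abs_div, Nat.abs_cast, abs_of_pos hS0]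
    rw [← Finset.sum_div, ← hS, div_self hS0.ne']
  · have hsum : ∑ j, ((t j : ℕ) : ℝ) / S * x j = (∑ j, ((t j : ℕ) : ℝ) * x j) / S := by
      rw [Finset.sum_div]
      exact Finset.sum_congr rfl fun j _ => by ring
    rw [hsum, abs_div, abs_of_pos hS0, ← mul_div_assoc, le_div_iff₀ hS0]
    have h1 := ht x hx i
    calc |x i| * S ≤ (2 * |∑ j, ((t j : ℕ) : ℝ) * x j|) * (n * (M : ℝ) ^ 2) :=
          mul_le_mul (by linarith) hSle hS0.le (by positivity)
      _ ≤ 4 * M ^ 2 * n * |∑ j, ((t j : ℕ) : ℝ) * x j| := by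
          have : 0 ≤ (M : ℝ) ^ 2 * n * |∑ j, ((t j : ℕ) : ℝ) * x j| := by positivity
          linarith
end

section
/- Let B = (A, {w_m}, {μ_m}) and B̂ = (A, {ŵ_m}, {μ̂_m}) be two LMAB instances with the same finite action set A, finite reward-value set Z ⊆ [−1,1], M latent contexts, and horizon H ≥ 1, with values V(π) and V̂(π) respectively. Then for every history-dependent policy π and every coupling Γ of w and ŵ: |V(π) − V̂(π)| ≤ H² · Σ_{(m,m')∈[M]²} Γ(m,m') · max_{a∈A} Σ_{z∈Z} |μ_m(a,z) − μ̂_{m'}(a,z)|. -/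
open scoped BigOperators

/-- The prefix of length `t` of a length-`H` sequence. -/
def prefixFn {α : Type*} {H : ℕ} (a : Fin H → α) (t : Fin H) : Fin t.1 → α :=
  fun j => a ⟨j.1, j.2.trans t.2⟩

/-- The value `V(π)` of a history-dependent policy `π` in an LMAB instance
with action set `A`, reward-value set `Z ⊆ ℝ`, mixing weights `w` and
reward distributions `μ`, over a horizon of `H` steps. -/
noncomputable def lmabValue {A : Type*} [Fintype A] (Z : Finset ℝ) (M H : ℕ)
    (w : Fin M → ℝ) (μ : Fin M → A → {z // z ∈ Z} → ℝ)
    (π : (t : Fin H) → (Fin t.1 → A) → (Fin t.1 → {z // z ∈ Z}) → A → ℝ) :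
    ℝ :=
  ∑ a : Fin H → A, ∑ r : Fin H → {z // z ∈ Z},
    (∑ t, (r t : ℝ)) *
      (∑ m, w m * ∏ t, μ m (a t) (r t)) *
      ∏ t, π t (prefixFn a t) (prefixFn r t) (a t)

/-- A sum over length-`(n + 1)` sequences splits off the last entry. -/
lemma sum_fin_snoc {α : Type*} [Fintype α] {n : ℕ} (f : (Fin (n + 1) → α) → ℝ) :
    ∑ a, f a = ∑ a : Fin n → α, ∑ x, f (Fin.snoc (α := fun _ => α) a x) := by
  rw [← (Fin.snocEquiv fun _ => α).sum_comp f, Fintype.sum_prod_type, Finset.sum_comm]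
  rfl

lemma prefixFn_snoc_castSucc {α : Type*} {n : ℕ} (a : Fin n → α) (x : α) (t : Fin n) :
    prefixFn (Fin.snoc (α := fun _ => α) a x) t.castSucc = prefixFn a t := by
  funext j
  exact Fin.snoc_castSucc (α := fun _ => α) x a ⟨j.1, j.2.trans t.2⟩

lemma prefixFn_snoc_last {α : Type*} {n : ℕ} (a : Fin n → α) (x : α) :
    prefixFn (Fin.snoc (α := fun _ => α) a x) (Fin.last n) = a := by
  funext j
  exact Fin.snoc_castSucc (α := fun _ => α) x a j

/-- The trajectory probabilities of a context under a policy sum to one. -/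
lemma sum_trajectory_eq_one {A ζ : Type*} [Fintype A] [Fintype ζ] {n : ℕ}
    (ν : A → ζ → ℝ) (hν : ∀ a, ∑ z, ν a z = 1)
    (π : (t : Fin n) → (Fin t.1 → A) → (Fin t.1 → ζ) → A → ℝ)
    (hπ : ∀ t h₁ h₂, ∑ a, π t h₁ h₂ a = 1) :
    ∑ a : Fin n → A, ∑ r : Fin n → ζ,
      (∏ t, ν (a t) (r t)) * ∏ t, π t (prefixFn a t) (prefixFn r t) (a t) = 1 := by
  induction n with
  | zero => simp
  | succ n ih =>
    rw [← ih (fun t => π t.castSucc) fun t => hπ t.castSucc, sum_fin_snoc]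
    refine Finset.sum_congr rfl fun a _ => ?_
    simp only [sum_fin_snoc (α := ζ)]
    rw [Finset.sum_comm]
    refine Finset.sum_congr rfl fun r _ => ?_
    simp only [Fin.prod_univ_castSucc, Fin.snoc_castSucc, Fin.snoc_last,
      prefixFn_snoc_castSucc, prefixFn_snoc_last]
    set P := ∏ t, ν (a t) (r t)
    set Q := ∏ t : Fin n, π t.castSucc (prefixFn a t) (prefixFn r t) (a t)
    calc ∑ x, ∑ z, P * ν x z * (Q * π (Fin.last n) a r x)
        = ∑ x, (P * Q * π (Fin.last n) a r x) * ∑ z, ν x z := by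
          simp only [Finset.mul_sum]
          exact Finset.sum_congr rfl fun x _ => Finset.sum_congr rfl fun z _ => by ring
      _ = P * Q := by
          simp only [hν, mul_one, ← Finset.mul_sum]
          exact (congrArg (P * Q * ·) (hπ (Fin.last n) a r)).trans (mul_one _)

/-- The `ℓ¹` distance between the trajectory laws of two contexts under the same policy grows
at most linearly in the horizon. -/
lemma sum_trajectory_abs_sub_le {A ζ : Type*} [Fintype A] [Fintype ζ] {n : ℕ}
    (μ ν : A → ζ → ℝ) (hμ0 : ∀ a z, 0 ≤ μ a z) (hν0 : ∀ a z, 0 ≤ ν a z)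
    (hμ : ∀ a, ∑ z, μ a z = 1) (hν : ∀ a, ∑ z, ν a z = 1)
    {ε : ℝ} (hε : ∀ a, ∑ z, |μ a z - ν a z| ≤ ε)
    (π : (t : Fin n) → (Fin t.1 → A) → (Fin t.1 → ζ) → A → ℝ)
    (hπ0 : ∀ t h₁ h₂ a, 0 ≤ π t h₁ h₂ a)
    (hπ : ∀ t h₁ h₂, ∑ a, π t h₁ h₂ a = 1) :
    ∑ a : Fin n → A, ∑ r : Fin n → ζ,
      |∏ t, μ (a t) (r t) - ∏ t, ν (a t) (r t)| *
        ∏ t, π t (prefixFn a t) (prefixFn r t) (a t) ≤ n * ε := by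
  induction n with
  | zero => simp
  | succ n ih =>
    have key := ih (fun t => π t.castSucc) (fun t => hπ0 t.castSucc) fun t => hπ t.castSucc
    have one := sum_trajectory_eq_one ν hν (fun t : Fin n => π t.castSucc)
      fun t => hπ t.castSucc
    have split : ((n + 1 : ℕ) : ℝ) * ε = n * ε + 1 * ε := by push_cast; ring
    rw [split, ← one]
    refine le_trans ?_ (add_le_add_left key _)
    rw [sum_fin_snoc, Finset.sum_mul, ← Finset.sum_add_distrib]
    refine Finset.sum_le_sum fun a _ => ?_
    simp only [sum_fin_snoc (α := ζ)]
    rw [Finset.sum_comm, Finset.sum_mul, ← Finset.sum_add_distrib]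
    refine Finset.sum_le_sum fun r _ => ?_
    simp only [Fin.prod_univ_castSucc, Fin.snoc_castSucc, Fin.snoc_last,
      prefixFn_snoc_castSucc, prefixFn_snoc_last]
    have hP' : 0 ≤ ∏ t, ν (a t) (r t) := Finset.prod_nonneg fun t _ => hν0 _ _
    have hQ' : 0 ≤ ∏ t : Fin n, π t.castSucc (prefixFn a t) (prefixFn r t) (a t) :=
      Finset.prod_nonneg fun t _ => hπ0 _ _ _ _
    set P := ∏ t, μ (a t) (r t)
    set P' := ∏ t, ν (a t) (r t)
    set Q := ∏ t : Fin n, π t.castSucc (prefixFn a t) (prefixFn r t) (a t)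
    have step : ∀ x z, |P * μ x z - P' * ν x z| ≤ |P - P'| * μ x z + P' * |μ x z - ν x z| := by
      intro x z
      calc |P * μ x z - P' * ν x z| = |(P - P') * μ x z + P' * (μ x z - ν x z)| := by
            congr 1; ring
        _ ≤ _ := by
            refine (abs_add_le _ _).trans_eq ?_
            rw [abs_mul, abs_mul, abs_of_nonneg (hμ0 x z), abs_of_nonneg hP']
    have inner : ∀ x, ∑ z, |P * μ x z - P' * ν x z| ≤ |P - P'| + P' * ε := by
      intro x
      refine (Finset.sum_le_sum fun z _ => step x z).trans ?_
      rw [Finset.sum_add_distrib, ← Finset.mul_sum, ← Finset.mul_sum, hμ, mul_one]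
      gcongr
      exact hε x
    calc ∑ x, ∑ z, |P * μ x z - P' * ν x z| * (Q * π (Fin.last n) a r x)
        = ∑ x, (Q * π (Fin.last n) a r x) * ∑ z, |P * μ x z - P' * ν x z| := by
          simp only [Finset.mul_sum]
          exact Finset.sum_congr rfl fun x _ => Finset.sum_congr rfl fun z _ => mul_comm _ _
      _ ≤ ∑ x, (Q * π (Fin.last n) a r x) * (|P - P'| + P' * ε) :=
          Finset.sum_le_sum fun x _ =>
            mul_le_mul_of_nonneg_left (inner x) (mul_nonneg hQ' (hπ0 _ _ _ _))
      _ = Q * (|P - P'| + P' * ε) := by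
          rw [← Finset.sum_mul, ← Finset.mul_sum]
          exact congrArg (· * (|P - P'| + P' * ε))
            ((congrArg (Q * ·) (hπ (Fin.last n) a r)).trans (mul_one _))
      _ = |P - P'| * Q + P' * Q * ε := by ring

theorem stmt9 (A : Type*) [Fintype A] [Nonempty A]
    (Z : Finset ℝ) (hZ : ∀ z ∈ Z, |z| ≤ 1)
    (M H : ℕ) (hH : 1 ≤ H)
    (w wh : Fin M → ℝ) (hw0 : ∀ m, 0 ≤ w m) (hwh0 : ∀ m, 0 ≤ wh m)
    (hw1 : ∑ m, w m = 1) (hwh1 : ∑ m, wh m = 1)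
    (μ μh : Fin M → A → {z // z ∈ Z} → ℝ)
    (hμ0 : ∀ m a z, 0 ≤ μ m a z) (hμh0 : ∀ m a z, 0 ≤ μh m a z)
    (hμ1 : ∀ m a, ∑ z, μ m a z = 1) (hμh1 : ∀ m a, ∑ z, μh m a z = 1)
    (π : (t : Fin H) → (Fin t.1 → A) → (Fin t.1 → {z // z ∈ Z}) → A → ℝ)
    (hπ0 : ∀ t h1 h2 a, 0 ≤ π t h1 h2 a)
    (hπ1 : ∀ t h1 h2, ∑ a, π t h1 h2 a = 1)
    (Γ : Fin M → Fin M → ℝ) (hΓ0 : ∀ m m', 0 ≤ Γ m m')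
    (hΓw : ∀ m, ∑ m', Γ m m' = w m) (hΓwh : ∀ m', ∑ m, Γ m m' = wh m') :
    |lmabValue Z M H w μ π - lmabValue Z M H wh μh π| ≤
      (H : ℝ) ^ 2 * ∑ m, ∑ m', Γ m m' *
        (Finset.univ.sup' Finset.univ_nonempty
          fun a : A => ∑ z, |μ m a z - μh m' a z|) := by
  have hdiff : lmabValue Z M H w μ π - lmabValue Z M H wh μh π =
      ∑ m, ∑ m', Γ m m' * ∑ a : Fin H → A, ∑ r : Fin H → {z // z ∈ Z},
        (∑ t, (r t : ℝ)) * ((∏ t, μ m (a t) (r t) - ∏ t, μh m' (a t) (r t)) *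
          ∏ t, π t (prefixFn a t) (prefixFn r t) (a t)) := by
    have mix : ∀ (a : Fin H → A) (r : Fin H → {z // z ∈ Z}),
        (∑ m, w m * ∏ t, μ m (a t) (r t)) - ∑ m, wh m * ∏ t, μh m (a t) (r t) =
          ∑ m, ∑ m', Γ m m' * (∏ t, μ m (a t) (r t) - ∏ t, μh m' (a t) (r t)) := by
      intro a r
      simp only [← hΓw, ← hΓwh, Finset.sum_mul, mul_sub, Finset.sum_sub_distrib]
      congr 1
      exact Finset.sum_comm
    simp only [lmabValue, ← Finset.sum_sub_distrib, ← sub_mul, ← mul_sub, mix]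
    simp only [Finset.mul_sum (s := (Finset.univ : Finset (Fin H → A))),
      Finset.mul_sum (s := (Finset.univ : Finset (Fin H → {z // z ∈ Z})))]
    simp only [Finset.sum_comm (s := (Finset.univ : Finset (Fin M)))
      (t := (Finset.univ : Finset (Fin H → A))),
      Finset.sum_comm (s := (Finset.univ : Finset (Fin M)))
      (t := (Finset.univ : Finset (Fin H → {z // z ∈ Z})))]
    refine Finset.sum_congr rfl fun a _ => Finset.sum_congr rfl fun r _ => ?_
    rw [mul_right_comm, Finset.mul_sum]
    refine Finset.sum_congr rfl fun m _ => ?_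
    rw [Finset.mul_sum]
    exact Finset.sum_congr rfl fun m' _ => by ring
  have hR : ∀ r : Fin H → {z // z ∈ Z}, |∑ t, (r t : ℝ)| ≤ H := fun r =>
    (Finset.abs_sum_le_sum_abs _ _).trans <|
      (Finset.sum_le_sum fun t _ => hZ _ (r t).2).trans_eq (by simp)
  rw [hdiff, Finset.mul_sum]
  refine (Finset.abs_sum_le_sum_abs _ _).trans (Finset.sum_le_sum fun m _ => ?_)
  rw [Finset.mul_sum]
  refine (Finset.abs_sum_le_sum_abs _ _).trans (Finset.sum_le_sum fun m' _ => ?_)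
  rw [abs_mul, abs_of_nonneg (hΓ0 m m'), mul_left_comm]
  refine mul_le_mul_of_nonneg_left ?_ (hΓ0 m m')
  have tv := sum_trajectory_abs_sub_le (μ m) (μh m') (hμ0 m) (hμh0 m') (hμ1 m) (hμh1 m')
    (ε := Finset.univ.sup' Finset.univ_nonempty fun a : A => ∑ z, |μ m a z - μh m' a z|)
    (fun a => Finset.le_sup' (fun a : A => ∑ z, |μ m a z - μh m' a z|) (Finset.mem_univ a))
    π hπ0 hπ1
  rw [sq, mul_assoc]
  refine le_trans ?_ (mul_le_mul_of_nonneg_left tv (Nat.cast_nonneg H))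
  rw [Finset.mul_sum]
  refine (Finset.abs_sum_le_sum_abs _ _).trans (Finset.sum_le_sum fun a _ => ?_)
  rw [Finset.mul_sum]
  refine (Finset.abs_sum_le_sum_abs _ _).trans (Finset.sum_le_sum fun r _ => ?_)
  rw [abs_mul, abs_mul, abs_of_nonneg (Finset.prod_nonneg fun t _ => hπ0 t _ _ _)]
  exact mul_le_mul_of_nonneg_right (hR r)
    (mul_nonneg (abs_nonneg _) (Finset.prod_nonneg fun t _ => hπ0 t _ _ _))
end

section
/- Let D and n be positive integers, let M ≥ 1, and let T ∈ ℝ^{D×n} be a matrix each of whose rows has ℓ1-norm at most √(2M). Let w_1,…,w_M, ŵ_1,…,ŵ_M ≥ 0 and ν_1,…,ν_M, ν̂_1,…,ν̂_M ∈ ℝ^n, and set μ_m = Tν_m and μ̂_m = Tν̂_m ∈ ℝ^D. If for some l ≥ 1 one has ‖Σ_{m=1}^M w_m ν_m^{⊗l} − Σ_{m=1}^M ŵ_m ν̂_m^{⊗l}‖_∞ ≤ δ, then ‖Σ_{m=1}^M w_m μ_m^{⊗l} − Σ_{m=1}^M ŵ_m μ̂_m^{⊗l}‖_∞ ≤ (2M)^{l/2}·δ.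 -/
open scoped BigOperators Matrix

/-- Entries of the tensor power of `T *ᵥ v` in terms of entries of the tensor power of `v`. -/
theorem prod_mulVec_eq_sum {ι m n R : Type*} [Fintype ι] [DecidableEq ι] [Fintype n]
    [CommSemiring R] (T : Matrix m n R) (v : n → R) (idx : ι → m) :
    ∏ j, (T *ᵥ v) (idx j) = ∑ f : ι → n, (∏ j, T (idx j) (f j)) * ∏ j, v (f j) := by
  simp only [Matrix.mulVec, dotProduct, Fintype.prod_sum, Finset.prod_mul_distrib]

theorem stmt12 (D n M l : ℕ) (hD : 1 ≤ D) (hn : 1 ≤ n) (hM : 1 ≤ M)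
    (hl : 1 ≤ l)
    (T : Matrix (Fin D) (Fin n) ℝ)
    (hT : ∀ i : Fin D, ∑ j, |T i j| ≤ Real.sqrt (2 * M))
    (w wh : Fin M → ℝ) (hw : ∀ m, 0 ≤ w m) (hwh : ∀ m, 0 ≤ wh m)
    (ν νh : Fin M → Fin n → ℝ) (δ : ℝ)
    (hmom : ∀ idx : Fin l → Fin n,
      |∑ m, w m * ∏ j, ν m (idx j) - ∑ m, wh m * ∏ j, νh m (idx j)| ≤ δ) :
    ∀ idx : Fin l → Fin D,
      |∑ m, w m * ∏ j, (T *ᵥ ν m) (idx j) -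
          ∑ m, wh m * ∏ j, (T *ᵥ νh m) (idx j)| ≤
        (2 * (M : ℝ)) ^ ((l : ℝ) / 2) * δ := by
  intro idx
  have hδ : 0 ≤ δ := (abs_nonneg _).trans (hmom fun _ => ⟨0, hn⟩)
  have expand (u : Fin M → ℝ) (x : Fin M → Fin n → ℝ) :
      ∑ m, u m * ∏ j, (T *ᵥ x m) (idx j) =
        ∑ f : Fin l → Fin n, (∏ j, T (idx j) (f j)) * ∑ m, u m * ∏ j, x m (f j) := by
    simp only [prod_mulVec_eq_sum, Finset.mul_sum]
    rw [Finset.sum_comm]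
    exact Finset.sum_congr rfl fun f _ => Finset.sum_congr rfl fun m _ => by ring
  have hpow : (2 * (M : ℝ)) ^ ((l : ℝ) / 2) = Real.sqrt (2 * M) ^ l := by
    rw [Real.sqrt_eq_rpow, ← Real.rpow_mul_natCast (by positivity)]
    congr 1
    ring
  rw [expand, expand, ← Finset.sum_sub_distrib, hpow]
  calc |∑ f : Fin l → Fin n, ((∏ j, T (idx j) (f j)) * ∑ m, w m * ∏ j, ν m (f j) -
          (∏ j, T (idx j) (f j)) * ∑ m, wh m * ∏ j, νh m (f j))|
      ≤ ∑ f : Fin l → Fin n, (∏ j, |T (idx j) (f j)|) * δ := by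
        refine (Finset.abs_sum_le_sum_abs _ _).trans (Finset.sum_le_sum fun f _ => ?_)
        rw [← mul_sub, abs_mul, Finset.abs_prod]
        exact mul_le_mul_of_nonneg_left (hmom f) (Finset.prod_nonneg fun _ _ => abs_nonneg _)
    _ = (∏ j, ∑ k, |T (idx j) k|) * δ := by
        rw [Fintype.prod_sum, Finset.sum_mul]
    _ ≤ Real.sqrt (2 * M) ^ l * δ := by
        refine mul_le_mul_of_nonneg_right ?_ hδ
        calc ∏ j, ∑ k, |T (idx j) k| ≤ ∏ _j : Fin l, Real.sqrt (2 * M) :=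
              Finset.prod_le_prod (fun _ _ => Finset.sum_nonneg fun _ _ => abs_nonneg _)
                fun j _ => hT (idx j)
          _ = Real.sqrt (2 * M) ^ l := by simp
end

section
/- For all real numbers μ and μ': ∫_ℝ |(1/√(2π))·exp(−(x−μ)²/2) − (1/√(2π))·exp(−(x−μ')²/2)| dx ≤ 2·|μ − μ'|. Equivalently, the total variation distance between the Gaussian distributions N(μ,1) and N(μ',1) is at most |μ − μ'|. -/
open MeasureTheory

theorem setIntegral_Iic_comp_sub_right (g : ℝ → ℝ) (m a : ℝ) :
    ∫ x in Set.Iic m, g (x - a) = ∫ x in Set.Iic (m - a), g x := by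
  rw [← integral_indicator measurableSet_Iic, ← integral_indicator measurableSet_Iic,
    ← integral_sub_right_eq_self ((Set.Iic (m - a)).indicator g) a]
  congr 1 with x
  simp [Set.indicator_apply]

/-- If `g` is integrable, bounded by one and decreasing in the absolute value of its argument, then
the `L¹` distance between two translates of `g` is at most twice the distance of the shifts. -/
theorem integral_abs_translate_sub_le {g : ℝ → ℝ} (hg : Integrable g)
    (h_anti : ∀ x y, |x| ≤ |y| → g y ≤ g x) (h_bound : ∀ x, |g x| ≤ 1) {a b : ℝ} (hab : a ≤ b) :
    ∫ x, |g (x - a) - g (x - b)| ≤ 2 * (b - a) := by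
  set m := (a + b) / 2 with hm
  have ha : Integrable fun x => g (x - a) := hg.comp_sub_right a
  have hb : Integrable fun x => g (x - b) := hg.comp_sub_right b
  have hf : Integrable fun x => g (x - a) - g (x - b) := ha.sub hb
  have h_zero : ∫ x, (g (x - a) - g (x - b)) = 0 := by
    rw [integral_sub ha hb, integral_sub_right_eq_self, integral_sub_right_eq_self, sub_self]
  have h_left : ∫ x in Set.Iic m, |g (x - a) - g (x - b)| =
      ∫ x in Set.Iic m, (g (x - a) - g (x - b)) := by
    refine setIntegral_congr_fun measurableSet_Iic fun x hx => abs_of_nonneg ?_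
    refine sub_nonneg.2 (h_anti _ _ (sq_le_sq.1 ?_))
    have : x ≤ m := hx
    nlinarith
  have h_right : ∫ x in Set.Ioi m, |g (x - a) - g (x - b)| =
      -∫ x in Set.Ioi m, (g (x - a) - g (x - b)) := by
    rw [← integral_neg]
    refine setIntegral_congr_fun measurableSet_Ioi fun x hx => abs_of_nonpos ?_
    refine sub_nonpos.2 (h_anti _ _ (sq_le_sq.1 ?_))
    have : m < x := hx
    nlinarith
  have h_split := integral_add_compl (measurableSet_Iic (a := m)) hf
  have h_split_abs := integral_add_compl (measurableSet_Iic (a := m)) hf.abs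
  rw [Set.compl_Iic] at h_split h_split_abs
  have h_half : ∫ x in Set.Iic m, (g (x - a) - g (x - b)) = ∫ x in (m - b)..(m - a), g x := by
    rw [integral_sub ha.integrableOn hb.integrableOn, setIntegral_Iic_comp_sub_right,
      setIntegral_Iic_comp_sub_right,
      intervalIntegral.integral_Iic_sub_Iic hg.integrableOn hg.integrableOn]
  have h_le := intervalIntegral.norm_integral_le_of_norm_le_const (a := m - b) (b := m - a)
    (f := g) (C := 1) fun x _ => h_bound x
  rw [sub_sub_sub_cancel_left, abs_of_nonneg (sub_nonneg.2 hab), one_mul] at h_le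
  have := (le_abs_self _).trans h_le
  linarith

theorem integral_abs_gaussian_sub_le {a b : ℝ} (hab : a ≤ b) :
    ∫ x : ℝ,
        |(Real.sqrt (2 * Real.pi))⁻¹ * Real.exp (-(x - a) ^ 2 / 2) -
          (Real.sqrt (2 * Real.pi))⁻¹ * Real.exp (-(x - b) ^ 2 / 2)| ≤ 2 * (b - a) := by
  refine integral_abs_translate_sub_le
    (g := fun x => (Real.sqrt (2 * Real.pi))⁻¹ * Real.exp (-x ^ 2 / 2)) ?_ ?_ ?_ hab
  · simpa [ProbabilityTheory.gaussianPDFReal_def] using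
      ProbabilityTheory.integrable_gaussianPDFReal 0 1
  · intro x y hxy
    have := sq_le_sq.2 hxy
    gcongr
  · intro x
    have h_sqrt : (Real.sqrt (2 * Real.pi))⁻¹ ≤ 1 :=
      inv_le_one_of_one_le₀ (Real.one_le_sqrt.2 (by linarith [Real.pi_gt_three]))
    have h_exp : Real.exp (-x ^ 2 / 2) ≤ 1 := Real.exp_le_one_iff.2 (by nlinarith [sq_nonneg x])
    rw [abs_of_nonneg (by positivity)]
    exact mul_le_one₀ h_sqrt (Real.exp_nonneg _) h_exp

theorem stmt19 (μ μ' : ℝ) :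
    ∫ x : ℝ,
        |(Real.sqrt (2 * Real.pi))⁻¹ * Real.exp (-(x - μ) ^ 2 / 2) -
          (Real.sqrt (2 * Real.pi))⁻¹ * Real.exp (-(x - μ') ^ 2 / 2)| ≤
      2 * |μ - μ'| := by
  rcases le_total μ μ' with h | h
  · rw [abs_sub_comm μ, abs_of_nonneg (sub_nonneg.2 h)]
    exact integral_abs_gaussian_sub_le h
  · rw [abs_of_nonneg (sub_nonneg.2 h)]
    simp_rw [abs_sub_comm (_ * Real.exp (-(_ - μ) ^ 2 / 2))]
    exact integral_abs_gaussian_sub_le h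
end
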